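/- arXiv:1709.08923 — 9 statements merged into one kernel-verified Lean document; each statement's English description precedes it below -/
import Mathlib

section
/- For every ν > 0, b > 0 and every a with −1 < a < ν, one has ∫_0^{1/(2b)} (1/(2x) − b)^a x^{ν−1} e^{−x} dx = b^{a−ν} 2^{−ν} e^{−1/(2b)} · (Γ(a+1)Γ(ν−a)/Γ(ν+1)) · Φ(a+1, ν+1; 1/(2b)). -/
open MeasureTheory ProbabilityTheory Real Set

/-- Kummer's confluent hypergeometric function `Φ(α,β;z)`, via the Euler integral
`Φ(α,β;z) = (Γ(β)/(Γ(α)Γ(β−α))) ∫_0^1 t^{α−1}(1−t)^{β−α−1} e^{zt} dt`. -/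
noncomputable def Phi (α β z : ℝ) : ℝ :=
  (Real.Gamma β / (Real.Gamma α * Real.Gamma (β - α))) *
    ∫ t in Set.Ioo (0:ℝ) 1, t ^ (α - 1) * (1 - t) ^ (β - α - 1) * Real.exp (z * t)

/-- Tricomi's confluent hypergeometric function `Ψ(α,β;z)`, via the integral
`Ψ(α,β;z) = (1/Γ(α)) ∫_0^∞ e^{−zt} t^{α−1} (1+t)^{β−α−1} dt`. -/
noncomputable def Psi (α β z : ℝ) : ℝ :=
  (Real.Gamma α)⁻¹ *
    ∫ t in Set.Ioi (0:ℝ), Real.exp (-(z * t)) * t ^ (α - 1) * (1 + t) ^ (β - α - 1)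

/-- The inverse-gamma law with parameter `ν`: the pushforward of the `Gamma(ν,1)`
distribution under the map `x ↦ 1/(2x)`. -/
noncomputable def invGammaLaw (ν : ℝ) : Measure ℝ :=
  Measure.map (fun x => 1 / (2 * x)) (gammaMeasure ν 1)

theorem stmt0 (ν b a : ℝ) (hν : 0 < ν) (hb : 0 < b) (ha1 : -1 < a) (ha2 : a < ν) :
    ∫ x in Set.Ioo (0:ℝ) (1 / (2 * b)), (1 / (2 * x) - b) ^ a * x ^ (ν - 1) * Real.exp (-x)
      = b ^ (a - ν) * 2 ^ (-ν) * Real.exp (-(1 / (2 * b))) *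
          (Real.Gamma (a + 1) * Real.Gamma (ν - a) / Real.Gamma (ν + 1)) *
          Phi (a + 1) (ν + 1) (1 / (2 * b)) := by
  set c : ℝ := 1 / (2 * b) with hc
  have hc0 : 0 < c := by positivity
  have hΓ : Real.Gamma (a + 1) ≠ 0 := (Real.Gamma_pos_of_pos (by linarith)).ne'
  have hΓa : Real.Gamma (ν - a) ≠ 0 := (Real.Gamma_pos_of_pos (by linarith)).ne'
  have hΓν : Real.Gamma (ν + 1) ≠ 0 := (Real.Gamma_pos_of_pos (by linarith)).ne'
  have hcν : c * (b ^ a * c ^ (ν - 1)) = b ^ (a - ν) * 2 ^ (-ν) := by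
    rw [rpow_sub_one hc0.ne', rpow_sub hb, rpow_neg two_pos.le, hc,
      div_rpow one_pos.le (by positivity), mul_rpow two_pos.le hb.le, one_rpow]
    field_simp
  have hsubst : ∀ t ∈ Ioo (0 : ℝ) 1,
      (1 / (2 * (c - c * t)) - b) ^ a * (c - c * t) ^ (ν - 1) * Real.exp (-(c - c * t)) =
        b ^ a * c ^ (ν - 1) * Real.exp (-c) *
          (t ^ a * (1 - t) ^ (ν - a - 1) * Real.exp (c * t)) := by
    rintro t ⟨ht0, ht1⟩
    have h1t : 0 < 1 - t := sub_pos.2 ht1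
    have hbase : 1 / (2 * (c - c * t)) - b = b * (t / (1 - t)) := by
      rw [← mul_one_sub, hc]
      field_simp
      ring
    have hpow : (1 - t) ^ (ν - a - 1) = (1 - t) ^ (ν - 1) / (1 - t) ^ a := by
      rw [← rpow_sub h1t]
      congr 1
      ring
    have hexp : Real.exp (-(c - c * t)) = Real.exp (-c) * Real.exp (c * t) := by
      rw [← Real.exp_add]
      congr 1
      ring
    rw [hbase, hexp, hpow, ← mul_one_sub, mul_rpow hb.le (by positivity),
      div_rpow ht0.le h1t.le, mul_rpow hc0.le h1t.le]
    ring
  have hscale := intervalIntegral.mul_integral_comp_sub_mul (a := 0) (b := 1)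
    (f := fun x : ℝ => (1 / (2 * x) - b) ^ a * x ^ (ν - 1) * Real.exp (-x)) c c
  simp only [mul_one, mul_zero, sub_self, sub_zero] at hscale
  rw [intervalIntegral.integral_of_le zero_le_one, intervalIntegral.integral_of_le hc0.le,
    integral_Ioc_eq_integral_Ioo, integral_Ioc_eq_integral_Ioo,
    setIntegral_congr_fun measurableSet_Ioo hsubst, integral_const_mul] at hscale
  rw [← hscale, ← hcν, Phi, add_sub_cancel_right, add_sub_add_right_eq_sub]
  field_simp
end

section
/- Let μ₁ and μ₂ be probability measures on ℝ supported in the interval [0,1], and let ε > 0. If ∫ x^a dμ₁(x) = ∫ x^a dμ₂(x) for every real a with 0 < a < ε, then μ₁ = μ₂. -/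
open MeasureTheory Set

/-- For a measure carried by `[0, 1]`, the moments of positive order are values of the
moment-generating function of `log` on the part of the measure carried by `(0, 1]`. -/
lemma integral_rpow_eq_mgf_log {μ : Measure ℝ} (h : μ (Icc (0 : ℝ) 1)ᶜ = 0) {a : ℝ} (ha : 0 < a) :
    ∫ x, x ^ a ∂μ = ProbabilityTheory.mgf Real.log (μ.restrict (Ioc 0 1)) a := by
  rw [ProbabilityTheory.mgf, ← setIntegral_eq_integral_of_ae_compl_eq_zero (s := Ioc (0 : ℝ) 1)]
  · refine setIntegral_congr_fun measurableSet_Ioc fun x hx ↦ ?_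
    rw [Real.rpow_def_of_pos hx.1, mul_comm]
  · filter_upwards [mem_ae_iff.2 h] with x hx hx'
    obtain rfl : x = 0 := by
      by_contra h0
      exact hx' ⟨lt_of_le_of_ne hx.1 (Ne.symm h0), hx.2⟩
    exact Real.zero_rpow ha.ne'

lemma Ioi_subset_interior_integrableExpSet_log (μ : Measure ℝ) [IsFiniteMeasure μ] :
    Ioi 0 ⊆ interior (ProbabilityTheory.integrableExpSet Real.log (μ.restrict (Ioc 0 1))) := by
  refine interior_maximal (fun a ha ↦ ?_) isOpen_Ioi
  refine Integrable.of_bound (C := 1) (by fun_prop) ?_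
  filter_upwards [ae_restrict_mem measurableSet_Ioc] with x hx
  rw [Real.norm_eq_abs, Real.abs_exp, Real.exp_le_one_iff]
  exact mul_nonpos_of_nonneg_of_nonpos (le_of_lt ha) (Real.log_nonpos hx.1.le hx.2)

/-- If the moments of two measures carried by `[0, 1]` agree for orders in an interval `(0, ε)`,
they agree for all positive orders. -/
lemma integral_rpow_eq_of_forall_lt {μ₁ μ₂ : Measure ℝ} [IsFiniteMeasure μ₁] [IsFiniteMeasure μ₂]
    (h₁ : μ₁ (Icc (0 : ℝ) 1)ᶜ = 0) (h₂ : μ₂ (Icc (0 : ℝ) 1)ᶜ = 0) {ε : ℝ} (hε : 0 < ε)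
    (h : ∀ a : ℝ, 0 < a → a < ε → (∫ x, x ^ a ∂μ₁) = ∫ x, x ^ a ∂μ₂) {a : ℝ} (ha : 0 < a) :
    ∫ x, x ^ a ∂μ₁ = ∫ x, x ^ a ∂μ₂ := by
  rw [integral_rpow_eq_mgf_log h₁ ha, integral_rpow_eq_mgf_log h₂ ha]
  refine (ProbabilityTheory.analyticOnNhd_mgf.mono
    (Ioi_subset_interior_integrableExpSet_log μ₁)).eqOn_of_preconnected_of_eventuallyEq
    (ProbabilityTheory.analyticOnNhd_mgf.mono (Ioi_subset_interior_integrableExpSet_log μ₂))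
    isPreconnected_Ioi (z₀ := ε / 2) (mem_Ioi.2 (by positivity)) ?_ (mem_Ioi.2 ha)
  filter_upwards [Ioo_mem_nhds (half_pos hε) (half_lt_self hε)] with b hb
  rw [← integral_rpow_eq_mgf_log h₁ hb.1, ← integral_rpow_eq_mgf_log h₂ hb.1, h b hb.1 hb.2]

lemma Continuous.integrable_of_measure_compl_Icc {μ : Measure ℝ} [IsFiniteMeasure μ] {a b : ℝ}
    (h : μ (Icc a b)ᶜ = 0) {f : ℝ → ℝ} (hf : Continuous f) : Integrable f μ := by
  obtain ⟨C, hC⟩ := isCompact_Icc.exists_bound_of_continuousOn (hf.continuousOn (s := Icc a b))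
  refine Integrable.of_bound (C := C) hf.aestronglyMeasurable ?_
  filter_upwards [mem_ae_iff.2 h] with x hx using hC x hx

/-- A finite measure carried by a compact interval is determined by its moments. -/
lemma Measure.ext_of_moments_Icc {μ₁ μ₂ : Measure ℝ} [IsFiniteMeasure μ₁] [IsFiniteMeasure μ₂]
    {a b : ℝ} (h₁ : μ₁ (Icc a b)ᶜ = 0) (h₂ : μ₂ (Icc a b)ᶜ = 0)
    (h : ∀ n : ℕ, ∫ x, x ^ n ∂μ₁ = ∫ x, x ^ n ∂μ₂) : μ₁ = μ₂ := by
  have hpoly (p : Polynomial ℝ) : ∫ x, p.eval x ∂μ₁ = ∫ x, p.eval x ∂μ₂ := by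
    simp_rw [Polynomial.eval_eq_sum_range]
    rw [integral_finsetSum _ fun i _ ↦
        Continuous.integrable_of_measure_compl_Icc h₁ (by fun_prop),
      integral_finsetSum _ fun i _ ↦
        Continuous.integrable_of_measure_compl_Icc h₂ (by fun_prop)]
    simp_rw [integral_const_mul, h]
  have hclose (μ : Measure ℝ) [IsFiniteMeasure μ] (hμ : μ (Icc a b)ᶜ = 0) {f g : ℝ → ℝ}
      (hf : Continuous f) (hg : Continuous g) {δ : ℝ} (hfg : ∀ x ∈ Icc a b, |g x - f x| < δ) :
      |∫ x, g x ∂μ - ∫ x, f x ∂μ| ≤ δ * μ.real univ := by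
    rw [← integral_sub (hg.integrable_of_measure_compl_Icc hμ)
      (hf.integrable_of_measure_compl_Icc hμ), ← Real.norm_eq_abs]
    refine norm_integral_le_of_norm_le_const ?_
    filter_upwards [mem_ae_iff.2 hμ] with x hx using (hfg x hx).le
  refine ext_of_forall_integral_eq_of_IsFiniteMeasure fun f ↦ ?_
  refine eq_of_abs_sub_le_all fun η hη ↦ ?_
  set M := μ₁.real univ + μ₂.real univ + 1 with hM
  have hMpos : 0 < M := by positivity
  obtain ⟨p, hp⟩ := exists_polynomial_near_of_continuousOn a b f f.continuous.continuousOn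
    (η / M) (by positivity)
  have e₁ := hclose μ₁ h₁ f.continuous p.continuous hp
  have e₂ := hclose μ₂ h₂ f.continuous p.continuous hp
  rw [hpoly p, abs_sub_comm] at e₁
  have hδ : η / M * μ₁.real univ + η / M * μ₂.real univ + η / M = η := by
    rw [← mul_add, ← mul_add_one, ← hM, div_mul_cancel₀ _ hMpos.ne']
  have hpos : 0 < η / M := by positivity
  linarith [abs_sub_le (∫ x, f x ∂μ₁) (∫ x, p.eval x ∂μ₂) (∫ x, f x ∂μ₂)]

theorem stmt4 (μ₁ μ₂ : Measure ℝ) [IsProbabilityMeasure μ₁] [IsProbabilityMeasure μ₂]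
    (h₁ : μ₁ (Set.Icc (0:ℝ) 1)ᶜ = 0) (h₂ : μ₂ (Set.Icc (0:ℝ) 1)ᶜ = 0)
    (ε : ℝ) (hε : 0 < ε)
    (h : ∀ a : ℝ, 0 < a → a < ε → (∫ x, x ^ a ∂μ₁) = ∫ x, x ^ a ∂μ₂) :
    μ₁ = μ₂ := by
  refine Measure.ext_of_moments_Icc h₁ h₂ fun n ↦ ?_
  rcases n.eq_zero_or_pos with rfl | hn
  · simp
  · simpa using integral_rpow_eq_of_forall_lt h₁ h₂ hε h (Nat.cast_pos.2 hn)
end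

section
/- Fix ν > 0 and b > c > 0. Let Z be an inverse-gamma random variable and let S be a random variable with values in [0,1], independent of Z, such that (Z/b − 1)_+ and S·(Z/c − 1)_+ have the same distribution. Then for every a with 0 < a < ν, E[S^a] = (b^{−ν} e^{−1/(2b)} Φ(a+1, ν+1; 1/(2b))) / (c^{−ν} e^{−1/(2c)} Φ(a+1, ν+1; 1/(2c))). -/
open MeasureTheory ProbabilityTheory Real Set

theorem max_div_sub_one_rpow_integral_invGammaLaw {ν b a : ℝ} (hν : 0 < ν) (hb : 0 < b)
    (ha : 0 < a) :
    ∫ z, max (z / b - 1) 0 ^ a ∂(invGammaLaw ν) =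
      (1 / (2 * b)) ^ ν * Real.exp (-(1 / (2 * b))) / Real.Gamma ν *
        ∫ t in Set.Ioo (0:ℝ) 1, t ^ (a + 1 - 1) * (1 - t) ^ (ν + 1 - (a + 1) - 1) *
          Real.exp (1 / (2 * b) * t) := by
  set w := 1 / (2 * b) with hw
  have hw0 : 0 < w := by positivity
  let f : ℝ → ℝ := fun x => gammaPDFReal ν 1 x * max (1 / (2 * x) / b - 1) 0 ^ a
  have hf : ∫ z, max (z / b - 1) 0 ^ a ∂(invGammaLaw ν) = ∫ x, f x := by
    rw [invGammaLaw, integral_map (by fun_prop) (Measurable.aestronglyMeasurable (by fun_prop)),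
      gammaMeasure, integral_withDensity_eq_integral_toReal_smul]
    · refine integral_congr_ae (Filter.Eventually.of_forall fun x => ?_)
      simp only [gammaPDF, smul_eq_mul, f]
      by_cases hx : 0 ≤ x
      · rw [ENNReal.toReal_ofReal (gammaPDFReal_nonneg hν one_pos x)]
      · simp [gammaPDFReal, hx]
    · exact (measurable_gammaPDFReal ν 1).ennreal_ofReal
    · exact Filter.Eventually.of_forall fun x => ENNReal.ofReal_lt_top
  have hsupp : ∫ x, f x = ∫ x in Set.Ioc 0 w, f x := by
    refine (setIntegral_eq_integral_of_forall_compl_eq_zero fun x hx => ?_).symm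
    simp only [f]
    rcases lt_or_ge x 0 with h | h
    · simp [gammaPDFReal, not_le.2 h]
    rcases h.eq_or_lt with rfl | h
    · simp [ha.ne']
    have hwx : w < x := by
      by_contra! h'
      exact hx ⟨h, h'⟩
    have : 1 / (2 * x) / b - 1 ≤ 0 := by
      have : 1 / (2 * x) / b = w / x := by rw [hw]; field_simp
      rw [this, sub_nonpos, div_le_one h]
      exact hwx.le
    rw [max_eq_right this, zero_rpow ha.ne', mul_zero]
  rw [hf, hsupp, ← intervalIntegral.integral_of_le hw0.le]
  have hcov := intervalIntegral.mul_integral_comp_sub_mul (a := 0) (b := 1) (f := f) w w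
  simp only [mul_one, mul_zero, sub_self, sub_zero] at hcov
  rw [← hcov, intervalIntegral.integral_of_le zero_le_one, integral_Ioc_eq_integral_Ioo,
    ← integral_const_mul, ← integral_const_mul]
  refine setIntegral_congr_fun measurableSet_Ioo fun t ht => ?_
  have h1 : 0 < 1 - t := sub_pos.2 ht.2
  have hx : w - w * t = w * (1 - t) := by ring
  have hq : 1 / (2 * (w * (1 - t))) / b - 1 = t / (1 - t) := by
    rw [hw]; field_simp; ring
  have hpos : 0 ≤ t / (1 - t) := div_nonneg ht.1.le h1.le
  simp only [f, hx, hq, max_eq_left hpos, gammaPDFReal, (mul_pos hw0 h1).le, if_true]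
  have e1 : ν + 1 - (a + 1) - 1 = (ν - 1) - a := by ring
  have e2 : a + 1 - 1 = a := by ring
  have e3 : -(1 * (w * (1 - t))) = -w + w * t := by ring
  have e4 : w ^ ν = w * w ^ (ν - 1) := by
    rw [rpow_sub_one hw0.ne']; field_simp
  rw [e1, e2, e3, e4, rpow_sub h1, div_rpow ht.1.le h1.le, mul_rpow hw0.le h1.le, Real.exp_add,
    one_rpow]
  ring

theorem kummer_integral_pos {a ν : ℝ} (w : ℝ) (ha : 0 < a) (haν : a < ν) :
    0 < ∫ t in Set.Ioo (0:ℝ) 1, t ^ (a + 1 - 1) * (1 - t) ^ (ν + 1 - (a + 1) - 1) *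
      Real.exp (w * t) := by
  have hint : IntervalIntegrable (fun t : ℝ => t ^ (a + 1 - 1) *
      (1 - t) ^ (ν + 1 - (a + 1) - 1) * Real.exp (w * t)) volume 0 1 := by
    have h1 : IntervalIntegrable (fun t : ℝ => t ^ (ν - a - 1)) volume 0 1 :=
      intervalIntegral.intervalIntegrable_rpow' (by linarith)
    have h2 : IntervalIntegrable (fun t : ℝ => (1 - t) ^ (ν - a - 1)) volume 0 1 := by
      simpa using (h1.comp_sub_left 1).symm
    have e1 : ν + 1 - (a + 1) - 1 = ν - a - 1 := by ring
    have e2 : a + 1 - 1 = a := by ring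
    simp only [e1, e2]
    refine (h2.continuousOn_mul ?_).mul_continuousOn ?_
    · exact (continuous_id.rpow_const fun _ => Or.inr ha.le).continuousOn
    · fun_prop
  rw [← integral_Ioc_eq_integral_Ioo, ← intervalIntegral.integral_of_le zero_le_one]
  refine intervalIntegral.intervalIntegral_pos_of_pos_on hint (fun t ht => ?_) zero_lt_one
  have h1 : 0 < 1 - t := sub_pos.2 ht.2
  have h0 : 0 < t := ht.1
  positivity

theorem stmt5 {Ω : Type*} [MeasurableSpace Ω] (P : Measure Ω) [IsProbabilityMeasure P]
    (ν b c : ℝ) (hν : 0 < ν) (hc : 0 < c) (hcb : c < b)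
    (Z S : Ω → ℝ) (hZm : Measurable Z) (hSm : Measurable S)
    (hZ : Measure.map Z P = invGammaLaw ν)
    (hS : ∀ᵐ ω ∂P, S ω ∈ Set.Icc (0:ℝ) 1)
    (hind : IndepFun S Z P)
    (hlaw : Measure.map (fun ω => max (Z ω / b - 1) 0) P
          = Measure.map (fun ω => S ω * max (Z ω / c - 1) 0) P) :
    ∀ a : ℝ, 0 < a → a < ν →
      (∫ ω, S ω ^ a ∂P)
        = (b ^ (-ν) * Real.exp (-(1 / (2 * b))) * Phi (a + 1) (ν + 1) (1 / (2 * b))) /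
          (c ^ (-ν) * Real.exp (-(1 / (2 * c))) * Phi (a + 1) (ν + 1) (1 / (2 * c))) := by
  intro a ha haν
  have hb : 0 < b := hc.trans hcb
  have hmap (d : ℝ) : ∫ ω, max (Z ω / d - 1) 0 ^ a ∂P
      = ∫ z, max (z / d - 1) 0 ^ a ∂(invGammaLaw ν) := by
    rw [← hZ, integral_map hZm.aemeasurable (Measurable.aestronglyMeasurable (by fun_prop))]
  have hmoment : ∫ ω, max (Z ω / b - 1) 0 ^ a ∂P
      = ∫ ω, (S ω * max (Z ω / c - 1) 0) ^ a ∂P := by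
    have h := congrArg (fun μ : Measure ℝ => ∫ y, y ^ a ∂μ) hlaw
    simpa only [integral_map (μ := P) (f := fun y : ℝ => y ^ a)
        (φ := fun ω => max (Z ω / b - 1) 0) (by fun_prop) (by fun_prop),
      integral_map (μ := P) (f := fun y : ℝ => y ^ a)
        (φ := fun ω => S ω * max (Z ω / c - 1) 0) (by fun_prop) (by fun_prop)] using h
  have hprod : ∫ ω, (S ω * max (Z ω / c - 1) 0) ^ a ∂P
      = (∫ ω, S ω ^ a ∂P) * ∫ ω, max (Z ω / c - 1) 0 ^ a ∂P := by
    have hind' : IndepFun (fun ω => S ω ^ a) (fun ω => max (Z ω / c - 1) 0 ^ a) P :=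
      hind.comp (φ := fun s : ℝ => s ^ a) (ψ := fun z : ℝ => max (z / c - 1) 0 ^ a)
        (by fun_prop) (by fun_prop)
    rw [← hind'.integral_fun_mul_eq_mul_integral
      (Measurable.aestronglyMeasurable (by fun_prop))
      (Measurable.aestronglyMeasurable (by fun_prop))]
    refine integral_congr_ae ?_
    filter_upwards [hS] with ω hω
    exact mul_rpow hω.1 (le_max_right _ _)
  rw [hprod, hmap b, hmap c, max_div_sub_one_rpow_integral_invGammaLaw hν hb ha,
    max_div_sub_one_rpow_integral_invGammaLaw hν hc ha] at hmoment
  have hscale {d : ℝ} (hd : 0 < d) : (1 / (2 * d)) ^ ν = (1 / 2) ^ ν * d ^ (-ν) := by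
    rw [rpow_neg hd.le, ← inv_rpow hd.le, ← mul_rpow (by norm_num) (by positivity)]
    congr 1
    field_simp
  rw [hscale hb, hscale hc] at hmoment
  have hIc := kummer_integral_pos (1 / (2 * c)) ha haν
  have hG : 0 < Real.Gamma (ν + 1) / (Real.Gamma (a + 1) * Real.Gamma (ν + 1 - (a + 1))) :=
    div_pos (Real.Gamma_pos_of_pos (by linarith))
      (mul_pos (Real.Gamma_pos_of_pos (by linarith)) (Real.Gamma_pos_of_pos (by linarith)))
  have hGν := Real.Gamma_pos_of_pos hν
  have hcν : 0 < c ^ (-ν) := rpow_pos_of_pos hc _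
  have h2ν : (0 : ℝ) < (1 / 2) ^ ν := by positivity
  have hexp := Real.exp_pos (-(1 / (2 * c)))
  unfold Phi
  rw [eq_div_iff (mul_pos (mul_pos hcν hexp) (mul_pos hG hIc)).ne']
  generalize Real.Gamma (ν + 1) / (Real.Gamma (a + 1) * Real.Gamma (ν + 1 - (a + 1))) = G at *
  refine mul_left_cancel₀ (div_pos h2ν hGν).ne' ?_
  linear_combination (-G) * hmoment
end

section
/- Fix ν > 0 and b > c > 0. Let Z be an inverse-gamma random variable, and let S₁ and S₂ be random variables with values in [0,1], each independent of Z, such that for i = 1,2 the random variables (Z/b − 1)_+ and Sᵢ·(Z/c − 1)_+ have the same distribution. Then S₁ and S₂ have the same distribution. -/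
open MeasureTheory ProbabilityTheory Real Set

/-- If `X` takes values in `[0, 1]`, then `log X` has exponential moments of every positive order
on the event `{0 < X}`. -/
lemma integrable_exp_mul_log_restrict_pos {Ω : Type*} [MeasurableSpace Ω] {P : Measure Ω}
    [IsFiniteMeasure P] {X : Ω → ℝ} (hX : Measurable X) (h01 : ∀ᵐ ω ∂P, X ω ∈ Icc (0 : ℝ) 1)
    {s : ℝ} (hs : 0 ≤ s) :
    Integrable (fun ω => exp (s * log (X ω))) (P.restrict {ω | 0 < X ω}) := by
  refine Integrable.of_mem_Icc 0 1 (by fun_prop) ?_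
  filter_upwards [ae_restrict_of_ae h01] with ω hω
  exact ⟨(exp_pos _).le, exp_le_one_iff.mpr
    (mul_nonpos_of_nonneg_of_nonpos hs (log_nonpos hω.1 hω.2))⟩

lemma integral_rpow_eq_mgf_log_s6 {Ω : Type*} [MeasurableSpace Ω] {P : Measure Ω}
    {X : Ω → ℝ} (hX : Measurable X) (h0 : ∀ᵐ ω ∂P, 0 ≤ X ω) {s : ℝ} (hs : 0 < s) :
    ∫ ω, X ω ^ s ∂P = mgf (fun ω => log (X ω)) (P.restrict {ω | 0 < X ω}) s := by
  have hm : MeasurableSet {ω | 0 < X ω} := measurableSet_lt measurable_const hX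
  rw [mgf, ← integral_indicator hm]
  refine integral_congr_ae ?_
  filter_upwards [h0] with ω hω
  rcases hω.eq_or_lt with h | h
  · simp [← h, zero_rpow hs.ne']
  · simp [h, rpow_def_of_pos h, mul_comm]

/-- The function `s ↦ E[X ^ s]` is real analytic on `(0, ∞)` when `X` takes values in `[0, 1]`. -/
lemma analyticOnNhd_integral_rpow {Ω : Type*} [MeasurableSpace Ω] {P : Measure Ω}
    [IsFiniteMeasure P] {X : Ω → ℝ} (hX : Measurable X) (h01 : ∀ᵐ ω ∂P, X ω ∈ Icc (0 : ℝ) 1) :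
    AnalyticOnNhd ℝ (fun s : ℝ => ∫ ω, X ω ^ s ∂P) (Ioi 0) := by
  have h : AnalyticOnNhd ℝ (mgf (fun ω => log (X ω)) (P.restrict {ω | 0 < X ω})) (Ioi 0) := by
    refine analyticOnNhd_mgf.mono (interior_maximal ?_ isOpen_Ioi)
    exact fun s hs => integrable_exp_mul_log_restrict_pos hX h01 (mem_Ioi.mp hs).le
  exact h.congr isOpen_Ioi fun s hs =>
    (integral_rpow_eq_mgf_log_s6 hX (h01.mono fun _ hω => hω.1) hs).symm

/-- Two bounded random variables with the same moments have the same law. -/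
lemma map_eq_of_integral_pow_eq {Ω : Type*} [MeasurableSpace Ω] {P : Measure Ω}
    [IsProbabilityMeasure P] {X Y : Ω → ℝ} {a b : ℝ} (hX : Measurable X) (hY : Measurable Y)
    (hXb : ∀ᵐ ω ∂P, X ω ∈ Icc a b) (hYb : ∀ᵐ ω ∂P, Y ω ∈ Icc a b)
    (h : ∀ n : ℕ, ∫ ω, X ω ^ n ∂P = ∫ ω, Y ω ^ n ∂P) :
    Measure.map X P = Measure.map Y P := by
  have hXs : integrableExpSet X P = univ :=
    eq_univ_of_forall fun t => integrable_exp_mul_of_mem_Icc hX.aemeasurable hXb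
  have hYs : integrableExpSet Y P = univ :=
    eq_univ_of_forall fun t => integrable_exp_mul_of_mem_Icc hY.aemeasurable hYb
  have hXa : AnalyticOnNhd ℝ (mgf X P) univ := by
    simpa [hXs] using analyticOnNhd_mgf (X := X) (μ := P)
  have hYa : AnalyticOnNhd ℝ (mgf Y P) univ := by
    simpa [hYs] using analyticOnNhd_mgf (X := Y) (μ := P)
  have h1 := hasFPowerSeriesAt_mgf (X := X) (μ := P) (v := 0) (by simp [hXs])
  have h2 := hasFPowerSeriesAt_mgf (X := Y) (μ := P) (v := 0) (by simp [hYs])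
  simp only [zero_mul, exp_zero, mul_one, h] at h1
  simp only [zero_mul, exp_zero, mul_one] at h2
  have hev : mgf X P =ᶠ[nhds 0] mgf Y P := by
    filter_upwards [h1.eventually_hasSum_sub, h2.eventually_hasSum_sub] with t ht1 ht2
    exact ht1.unique ht2
  have hmgf : mgf X P = mgf Y P := hXa.eq_of_eventuallyEq hYa hev
  refine Measure.ext_of_complexMGF_eq hX.aemeasurable hY.aemeasurable (funext fun z => ?_)
  exact eqOn_complexMGF_of_mgf hmgf (by simp [hXs])

/-- A law on `[0, 1]` is determined by its real moments of small positive order. -/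
lemma map_eq_of_integral_rpow_eq {Ω : Type*} [MeasurableSpace Ω] {P : Measure Ω}
    [IsProbabilityMeasure P] {X Y : Ω → ℝ} {r : ℝ} (hr : 0 < r)
    (hX : Measurable X) (hY : Measurable Y)
    (hX01 : ∀ᵐ ω ∂P, X ω ∈ Icc (0 : ℝ) 1) (hY01 : ∀ᵐ ω ∂P, Y ω ∈ Icc (0 : ℝ) 1)
    (h : ∀ s ∈ Ioo (0 : ℝ) r, ∫ ω, X ω ^ s ∂P = ∫ ω, Y ω ^ s ∂P) :
    Measure.map X P = Measure.map Y P := by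
  have hmid : r / 2 ∈ Ioo 0 r := ⟨by linarith, by linarith⟩
  have key : EqOn (fun s : ℝ => ∫ ω, X ω ^ s ∂P) (fun s : ℝ => ∫ ω, Y ω ^ s ∂P) (Ioi 0) :=
    (analyticOnNhd_integral_rpow hX hX01).eqOn_of_preconnected_of_eventuallyEq
      (analyticOnNhd_integral_rpow hY hY01) isPreconnected_Ioi (mem_Ioi.mpr hmid.1)
      (Filter.eventually_of_mem (Ioo_mem_nhds hmid.1 hmid.2) h)
  refine map_eq_of_integral_pow_eq hX hY hX01 hY01 fun n => ?_
  rcases n.eq_zero_or_pos with rfl | hn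
  · simp
  · simpa using key (mem_Ioi.mpr (Nat.cast_pos.mpr hn) : (n : ℝ) ∈ Ioi 0)

lemma measurable_gammaPDF (a r : ℝ) : Measurable (gammaPDF a r) :=
  (measurable_gammaPDFReal a r).ennreal_ofReal

lemma ae_pos_gammaMeasure (a r : ℝ) : ∀ᵐ x ∂(gammaMeasure a r), 0 < x := by
  rw [gammaMeasure, ae_withDensity_iff (measurable_gammaPDF a r)]
  filter_upwards [Measure.ae_ne volume (0 : ℝ)] with x hx0 hx
  by_contra hneg
  exact hx (gammaPDF_of_neg (lt_of_le_of_ne (not_lt.mp hneg) hx0))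

lemma ae_pos_invGammaLaw (ν : ℝ) : ∀ᵐ z ∂(invGammaLaw ν), 0 < z := by
  rw [invGammaLaw, ae_map_iff (by fun_prop) measurableSet_Ioi]
  filter_upwards [ae_pos_gammaMeasure ν 1] with x hx
  positivity

/-- The inverse-gamma law has finite moments of every order less than its parameter. -/
lemma integrable_rpow_invGammaLaw {ν s : ℝ} (hν : 0 < ν) (hs : s < ν) :
    Integrable (fun z : ℝ => z ^ s) (invGammaLaw ν) := by
  rw [invGammaLaw, integrable_map_measure (by fun_prop) (by fun_prop), gammaMeasure,
    integrable_withDensity_iff (measurable_gammaPDF ν 1)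
      (ae_of_all _ fun x => ENNReal.ofReal_lt_top)]
  have hg : IntegrableOn (fun x : ℝ => (1 / 2) ^ s * (Gamma ν)⁻¹ * (exp (-x) * x ^ (ν - s - 1)))
      (Ioi 0) := (Real.GammaIntegral_convergent (sub_pos.mpr hs)).const_mul _
  refine (hg.integrable_indicator measurableSet_Ioi).congr ?_
  filter_upwards [Measure.ae_ne volume (0 : ℝ)] with x hx0
  rcases lt_or_gt_of_ne hx0 with hx | hx
  · simp [gammaPDF_of_neg hx, hx.le]
  · have hpos := gammaPDFReal_nonneg hν one_pos x
    rw [indicator_of_mem (mem_Ioi.mpr hx)]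
    simp only [Function.comp, gammaPDF, ENNReal.toReal_ofReal hpos]
    rw [gammaPDFReal, if_pos hx.le, one_rpow, one_mul,
      show 1 / (2 * x) = 1 / 2 * x⁻¹ by field_simp, mul_rpow (by norm_num) (by positivity),
      inv_rpow hx.le, show ν - s - 1 = (ν - 1) - s by ring, rpow_sub hx (ν - 1) s]
    field_simp

/-- The inverse-gamma law has unbounded support. -/
lemma invGammaLaw_Ioi_ne_zero {ν c : ℝ} (hν : 0 < ν) (hc : 0 < c) :
    invGammaLaw ν (Ioi c) ≠ 0 := by
  rw [invGammaLaw, Measure.map_apply (by fun_prop) measurableSet_Ioi]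
  intro h0
  have hsub : Ioo (0 : ℝ) (1 / (2 * c)) ⊆ (fun x : ℝ => 1 / (2 * x)) ⁻¹' Ioi c := by
    rintro x ⟨hx0, hx⟩
    rw [lt_div_iff₀ (by positivity)] at hx
    rw [mem_preimage, mem_Ioi, lt_div_iff₀ (by positivity)]
    linarith
  have h1 := measure_mono_null hsub h0
  rw [gammaMeasure, withDensity_apply_eq_zero (measurable_gammaPDF ν 1)] at h1
  have h2 : Ioo (0 : ℝ) (1 / (2 * c)) ⊆
      {x | gammaPDF ν 1 x ≠ 0} ∩ Ioo 0 (1 / (2 * c)) := fun x hx =>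
    ⟨(ENNReal.ofReal_pos.mpr (gammaPDFReal_pos hν one_pos hx.1)).ne', hx⟩
  have h3 := measure_mono_null h2 h1
  rw [Real.volume_Ioo, ENNReal.ofReal_eq_zero] at h3
  have : 0 < 1 / (2 * c) := by positivity
  linarith

/-- For an inverse-gamma variable `Z`, the moments of `(Z / c - 1)₊` of order in `(0, ν)` are
positive; in particular the defining integrals converge. -/
lemma integral_rpow_posPart_invGammaLaw_pos {ν c s : ℝ} (hν : 0 < ν) (hc : 0 < c)
    (hs : s ∈ Ioo 0 ν) : 0 < ∫ z, max (z / c - 1) 0 ^ s ∂(invGammaLaw ν) := by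
  have hnn : 0 ≤ fun z : ℝ => max (z / c - 1) 0 ^ s := fun z => rpow_nonneg (le_max_right _ _) _
  have hint : Integrable (fun z : ℝ => max (z / c - 1) 0 ^ s) (invGammaLaw ν) := by
    refine ((integrable_rpow_invGammaLaw hν hs.2).const_mul ((c ^ s)⁻¹)).mono'
      (Measurable.aestronglyMeasurable (by fun_prop)) ?_
    filter_upwards [ae_pos_invGammaLaw ν] with z hz
    rw [norm_of_nonneg (hnn z), inv_mul_eq_div, ← div_rpow hz.le hc.le]
    exact rpow_le_rpow (le_max_right _ _) (max_le (by linarith) (by positivity)) hs.1.le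
  rw [integral_pos_iff_support_of_nonneg hnn hint, pos_iff_ne_zero]
  refine fun h => invGammaLaw_Ioi_ne_zero hν hc (measure_mono_null (fun z hz => ?_) h)
  have : 0 < z / c - 1 := by rw [sub_pos, one_lt_div hc]; exact hz
  exact (rpow_pos_of_pos (lt_max_of_lt_left this) _).ne'

theorem stmt6 {Ω : Type*} [MeasurableSpace Ω] (P : Measure Ω) [IsProbabilityMeasure P]
    (ν b c : ℝ) (hν : 0 < ν) (hc : 0 < c) (hcb : c < b)
    (Z S₁ S₂ : Ω → ℝ) (hZm : Measurable Z) (hS₁m : Measurable S₁) (hS₂m : Measurable S₂)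
    (hZ : Measure.map Z P = invGammaLaw ν)
    (hS₁ : ∀ᵐ ω ∂P, S₁ ω ∈ Set.Icc (0:ℝ) 1)
    (hS₂ : ∀ᵐ ω ∂P, S₂ ω ∈ Set.Icc (0:ℝ) 1)
    (hind₁ : IndepFun S₁ Z P) (hind₂ : IndepFun S₂ Z P)
    (hlaw₁ : Measure.map (fun ω => max (Z ω / b - 1) 0) P
           = Measure.map (fun ω => S₁ ω * max (Z ω / c - 1) 0) P)
    (hlaw₂ : Measure.map (fun ω => max (Z ω / b - 1) 0) P
           = Measure.map (fun ω => S₂ ω * max (Z ω / c - 1) 0) P) :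
    Measure.map S₁ P = Measure.map S₂ P := by
  have hmom : ∀ S : Ω → ℝ, Measurable S → (∀ᵐ ω ∂P, S ω ∈ Icc (0 : ℝ) 1) → IndepFun S Z P →
      ∀ s : ℝ, ∫ x, x ^ s ∂(Measure.map (fun ω => S ω * max (Z ω / c - 1) 0) P)
        = (∫ ω, S ω ^ s ∂P) * ∫ z, max (z / c - 1) 0 ^ s ∂(invGammaLaw ν) := by
    intro S hSm hS hind s
    have hind' : IndepFun (fun ω => S ω ^ s) (fun ω => max (Z ω / c - 1) 0 ^ s) P :=
      hind.comp (φ := fun x : ℝ => x ^ s) (ψ := fun z : ℝ => max (z / c - 1) 0 ^ s)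
        (by fun_prop) (by fun_prop)
    rw [integral_map (by fun_prop) (Measurable.aestronglyMeasurable (by fun_prop)), ← hZ,
      integral_map hZm.aemeasurable (Measurable.aestronglyMeasurable (by fun_prop)),
      ← hind'.integral_fun_mul_eq_mul_integral (Measurable.aestronglyMeasurable (by fun_prop))
        (Measurable.aestronglyMeasurable (by fun_prop))]
    refine integral_congr_ae ?_
    filter_upwards [hS] with ω hω
    exact mul_rpow hω.1 (le_max_right _ _)
  refine map_eq_of_integral_rpow_eq hν hS₁m hS₂m hS₁ hS₂ fun s hs => ?_
  refine mul_right_cancel₀ (integral_rpow_posPart_invGammaLaw_pos hν hc hs).ne' ?_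
  rw [← hmom S₁ hS₁m hS₁ hind₁ s, ← hmom S₂ hS₂m hS₂ hind₂ s, ← hlaw₁, hlaw₂]
end

section
/- Fix ν > 0 and 0 < b < c. Let Z be an inverse-gamma random variable and let S be a random variable with values in [0,1], independent of Z, such that (1 − Z/b)_+ and S·(1 − Z/c)_+ have the same distribution. Then for every a with 0 < a < ν, E[S^a] = (b^{−ν} e^{−1/(2b)} Ψ(a+1, ν+1; 1/(2b))) / (c^{−ν} e^{−1/(2c)} Ψ(a+1, ν+1; 1/(2c))). -/
open MeasureTheory ProbabilityTheory Real Set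

/-- Affine change of variables `x = k * (t + 1)` on a half-line. -/
theorem setIntegral_Ioi_eq_setIntegral_Ioi_zero_mul_add_one (F : ℝ → ℝ) {k : ℝ} (hk : 0 < k) :
    ∫ x in Ioi k, F x = ∫ t in Ioi (0:ℝ), k * F (k * (t + 1)) := by
  have h1 := integral_comp_mul_left_Ioi F 1 hk
  have h2 := (measurePreserving_add_right (volume : Measure ℝ) 1).setIntegral_preimage_emb
    (MeasurableEquiv.addRight (1:ℝ)).measurableEmbedding (fun y => F (k * y)) (Ioi 1)
  have hpre : (fun t : ℝ => t + 1) ⁻¹' Ioi 1 = Ioi 0 := by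
    ext t
    simp
  rw [hpre, h1, mul_one, smul_eq_mul] at h2
  rw [integral_const_mul, h2, mul_inv_cancel_left₀ hk.ne']

/-- The `a`-th moment of `(1 - Z / b)₊` for an inverse-gamma variable `Z`. -/
theorem integral_invGammaLaw_rpow_max_one_sub_div {ν a b : ℝ} (hν : 0 < ν) (ha : 0 < a)
    (hb : 0 < b) :
    ∫ z, max (1 - z / b) 0 ^ a ∂invGammaLaw ν
      = Real.Gamma (a + 1) / (Real.Gamma ν * 2 ^ ν) *
        (b ^ (-ν) * Real.exp (-(1 / (2 * b))) * Psi (a + 1) (ν + 1) (1 / (2 * b))) := by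
  have hΓ : Real.Gamma ν ≠ 0 := (Real.Gamma_pos_of_pos hν).ne'
  have hΓ' : Real.Gamma (a + 1) ≠ 0 := (Real.Gamma_pos_of_pos (by linarith)).ne'
  obtain ⟨k, hk, hbk⟩ : ∃ k : ℝ, 0 < k ∧ b = 1 / (2 * k) :=
    ⟨1 / (2 * b), by positivity, by field_simp⟩
  have hkb : 1 / (2 * b) = k := by rw [hbk]; field_simp
  have hpow : b ^ (-ν) = 2 ^ ν * k ^ ν := by
    rw [hbk, one_div, Real.inv_rpow (by positivity), Real.rpow_neg (by positivity), inv_inv,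
      Real.mul_rpow (by norm_num) hk.le]
  have hpdf : Measurable (gammaPDF ν 1) := (measurable_gammaPDFReal ν 1).ennreal_ofReal
  have hstep : ∫ z, max (1 - z / b) 0 ^ a ∂invGammaLaw ν
      = ∫ x in Ioi k, gammaPDFReal ν 1 x * max (1 - 1 / (2 * x) / b) 0 ^ a := by
    rw [invGammaLaw, integral_map (by fun_prop)
      (Measurable.aestronglyMeasurable (by fun_prop)), gammaMeasure,
      integral_withDensity_eq_integral_toReal_smul hpdf
        (ae_of_all _ fun _ => ENNReal.ofReal_lt_top)]
    simp_rw [gammaPDF, ENNReal.toReal_ofReal (gammaPDFReal_nonneg hν one_pos _), smul_eq_mul]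
    refine (setIntegral_eq_integral_of_ae_compl_eq_zero ?_).symm
    filter_upwards [Measure.ae_ne volume (0:ℝ)] with x hx0 hxk
    rcases lt_or_gt_of_ne hx0 with hx | hx
    · simp [gammaPDFReal, not_le.mpr hx]
    · have hle : 1 - 1 / (2 * x) / b ≤ 0 := by
        have hxk : x ≤ k := not_lt.mp hxk
        have : 1 / (2 * x) / b = k / x := by rw [hbk]; field_simp
        rw [this, sub_nonpos, one_le_div hx]
        exact hxk
      rw [max_eq_right hle, Real.zero_rpow ha.ne', mul_zero]
  rw [hstep, setIntegral_Ioi_eq_setIntegral_Ioi_zero_mul_add_one _ hk, Psi, hkb, hpow]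
  have hint : ∀ t ∈ Ioi (0:ℝ),
      k * (gammaPDFReal ν 1 (k * (t + 1)) * max (1 - 1 / (2 * (k * (t + 1))) / b) 0 ^ a)
        = k ^ ν * Real.exp (-k) / Real.Gamma ν *
          (Real.exp (-(k * t)) * t ^ (a + 1 - 1) * (1 + t) ^ (ν + 1 - (a + 1) - 1)) := by
    intro t ht
    have ht : 0 < t := ht
    have h1t : 0 < 1 + t := by linarith
    have hbase : max (1 - 1 / (2 * (k * (t + 1))) / b) 0 = t / (1 + t) := by
      have : 1 - 1 / (2 * (k * (t + 1))) / b = t / (1 + t) := by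
        rw [hbk, add_comm t 1]
        field_simp
        ring
      rw [this]
      exact max_eq_left (by positivity)
    have hexp : Real.exp (-(1 * (k * (1 + t)))) = Real.exp (-k) * Real.exp (-(k * t)) := by
      rw [← Real.exp_add]
      ring_nf
    rw [hbase, gammaPDFReal, if_pos (by positivity), Real.one_rpow, add_comm t 1, hexp,
      Real.mul_rpow hk.le h1t.le, Real.div_rpow ht.le h1t.le, Real.rpow_sub_one hk.ne',
      show ν + 1 - (a + 1) - 1 = (ν - 1) - a by ring, Real.rpow_sub h1t (ν - 1) a,
      add_sub_cancel_right]
    field_simp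
  rw [setIntegral_congr_fun measurableSet_Ioi hint, integral_const_mul]
  have h2 : (2:ℝ) ^ ν ≠ 0 := by positivity
  field_simp

/-- The `a`-th moment of `(1 - Z / b)₊` is positive. -/
theorem integral_invGammaLaw_rpow_max_one_sub_div_pos {ν a b : ℝ} (hν : 0 < ν) (ha : 0 < a)
    (hb : 0 < b) : 0 < ∫ z, max (1 - z / b) 0 ^ a ∂invGammaLaw ν := by
  have := isProbabilityMeasure_gammaMeasure hν one_pos
  have hm : Measurable fun x : ℝ => max (1 - 1 / (2 * x) / b) 0 ^ a := by fun_prop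
  rw [invGammaLaw, integral_map (by fun_prop) (Measurable.aestronglyMeasurable (by fun_prop))]
  have hpdf : Measurable (gammaPDF ν 1) := (measurable_gammaPDFReal ν 1).ennreal_ofReal
  have hae : ∀ᵐ x ∂gammaMeasure ν 1, 0 ≤ x := by
    rw [gammaMeasure, ae_withDensity_iff hpdf]
    refine ae_of_all _ fun x hx => ?_
    by_contra! h
    exact hx (gammaPDF_of_neg h)
  have hint : Integrable (fun x : ℝ => max (1 - 1 / (2 * x) / b) 0 ^ a) (gammaMeasure ν 1) := by
    refine Integrable.of_bound hm.aestronglyMeasurable 1 ?_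
    filter_upwards [hae] with x hx
    rw [Real.norm_of_nonneg (by positivity)]
    refine Real.rpow_le_one (le_max_right _ _) (max_le ?_ zero_le_one) ha.le
    have : 0 ≤ 1 / (2 * x) / b := by positivity
    linarith
  rw [integral_pos_iff_support_of_nonneg (fun x => by positivity) hint, pos_iff_ne_zero,
    gammaMeasure, Ne, withDensity_apply_eq_zero hpdf]
  have hsub : Ioi (1 / (2 * b)) ⊆ {x | gammaPDF ν 1 x ≠ 0} ∩
      Function.support fun x : ℝ => max (1 - 1 / (2 * x) / b) 0 ^ a := by
    intro x hx
    have hx : 1 / (2 * b) < x := hx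
    have hx0 : 0 < x := lt_trans (by positivity) hx
    refine ⟨(ENNReal.ofReal_pos.mpr (gammaPDFReal_pos hν one_pos hx0)).ne', ?_⟩
    have hlt : 0 < 1 - 1 / (2 * x) / b := by
      have : 1 / (2 * x) / b = 1 / (2 * b) / x := by field_simp
      rw [this, sub_pos, div_lt_one hx0]
      exact hx
    exact (Real.rpow_pos_of_pos (lt_max_of_lt_left hlt) a).ne'
  intro h
  have := measure_mono_null hsub h
  simp at this

theorem stmt7 {Ω : Type*} [MeasurableSpace Ω] (P : Measure Ω) [IsProbabilityMeasure P]
    (ν b c : ℝ) (hν : 0 < ν) (hb : 0 < b) (hbc : b < c)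
    (Z S : Ω → ℝ) (hZm : Measurable Z) (hSm : Measurable S)
    (hZ : Measure.map Z P = invGammaLaw ν)
    (hS : ∀ᵐ ω ∂P, S ω ∈ Set.Icc (0:ℝ) 1)
    (hind : IndepFun S Z P)
    (hlaw : Measure.map (fun ω => max (1 - Z ω / b) 0) P
          = Measure.map (fun ω => S ω * max (1 - Z ω / c) 0) P) :
    ∀ a : ℝ, 0 < a → a < ν →
      (∫ ω, S ω ^ a ∂P)
        = (b ^ (-ν) * Real.exp (-(1 / (2 * b))) * Psi (a + 1) (ν + 1) (1 / (2 * b))) /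
          (c ^ (-ν) * Real.exp (-(1 / (2 * c))) * Psi (a + 1) (ν + 1) (1 / (2 * c))) := by
  intro a ha _
  have hmb : Measurable fun z : ℝ => max (1 - z / b) 0 := by fun_prop
  have hmc : Measurable fun z : ℝ => max (1 - z / c) 0 := by fun_prop
  have hma : Measurable fun x : ℝ => x ^ a := by fun_prop
  have hc : 0 < c := hb.trans hbc
  have hmoment : ∀ d : ℝ, ∫ ω, max (1 - Z ω / d) 0 ^ a ∂P
      = ∫ z, max (1 - z / d) 0 ^ a ∂invGammaLaw ν := by
    intro d
    rw [← hZ, integral_map hZm.aemeasurable (Measurable.aestronglyMeasurable (by fun_prop))]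
  have hprod : ∫ ω, max (1 - Z ω / b) 0 ^ a ∂P
      = (∫ ω, S ω ^ a ∂P) * ∫ ω, max (1 - Z ω / c) 0 ^ a ∂P := by
    have h1 := integral_map (hmb.comp hZm).aemeasurable (μ := P) hma.aestronglyMeasurable
    have h2 := integral_map (hSm.mul (hmc.comp hZm)).aemeasurable (μ := P)
      hma.aestronglyMeasurable
    have h3 : ∫ ω, max (1 - Z ω / b) 0 ^ a ∂P
        = ∫ ω, (S ω * max (1 - Z ω / c) 0) ^ a ∂P := by
      refine h1.symm.trans (Eq.trans ?_ h2)
      exact congrArg (fun μ => ∫ x, x ^ a ∂μ) hlaw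
    rw [h3, ← hind.integral_fun_comp_mul_comp (f := fun s => s ^ a)
      (g := fun z => max (1 - z / c) 0 ^ a) hSm.aemeasurable hZm.aemeasurable
      hma.aestronglyMeasurable (hma.comp hmc).aestronglyMeasurable]
    refine integral_congr_ae ?_
    filter_upwards [hS] with ω hω
    exact Real.mul_rpow hω.1 (le_max_right _ _)
  have hpos := integral_invGammaLaw_rpow_max_one_sub_div_pos hν ha hc
  rw [hmoment, hmoment, integral_invGammaLaw_rpow_max_one_sub_div hν ha hb] at hprod
  rw [integral_invGammaLaw_rpow_max_one_sub_div hν ha hc] at hprod hpos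
  have hK := left_ne_zero_of_mul hpos.ne'
  have hD := right_ne_zero_of_mul hpos.ne'
  rw [eq_div_iff hD]
  refine mul_left_cancel₀ hK ?_
  rw [hprod]
  ring
end

section
/- Fix ν > 0 and 0 < b < c. Let Z be an inverse-gamma random variable, and let S₁ and S₂ be random variables with values in [0,1], each independent of Z, such that for i = 1,2 the random variables (1 − Z/b)_+ and Sᵢ·(1 − Z/c)_+ have the same distribution. Then S₁ and S₂ have the same distribution. -/
open MeasureTheory ProbabilityTheory Real Set

/-- Two finite measures carried by a compact interval and having the same moments are equal. -/
theorem Measure.eq_of_forall_integral_pow_eq {μ ν : Measure ℝ} [IsFiniteMeasure μ]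
    [IsFiniteMeasure ν] {a b : ℝ} (hμ : ∀ᵐ x ∂μ, x ∈ Icc a b) (hν : ∀ᵐ x ∂ν, x ∈ Icc a b)
    (h : ∀ n : ℕ, ∫ x, x ^ n ∂μ = ∫ x, x ^ n ∂ν) : μ = ν := by
  have integrable_of_continuous {ρ : Measure ℝ} [IsFiniteMeasure ρ]
      (hρ : ∀ᵐ x ∂ρ, x ∈ Icc a b) {g : ℝ → ℝ} (hg : Continuous g) : Integrable g ρ := by
    obtain ⟨C, hC⟩ := isCompact_Icc.exists_bound_of_continuousOn (hg.continuousOn (s := Icc a b))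
    exact Integrable.of_bound hg.aestronglyMeasurable C (hρ.mono hC)
  have integral_eval (p : Polynomial ℝ) : ∫ x, p.eval x ∂μ = ∫ x, p.eval x ∂ν := by
    simp_rw [Polynomial.eval_eq_sum_range]
    rw [integral_finsetSum _ fun i _ => integrable_of_continuous hμ (by fun_prop),
      integral_finsetSum _ fun i _ => integrable_of_continuous hν (by fun_prop)]
    simp_rw [integral_const_mul, h]
  have integral_near {ρ : Measure ℝ} [IsFiniteMeasure ρ] (hρ : ∀ᵐ x ∂ρ, x ∈ Icc a b)
      {f g : ℝ → ℝ} (hf : Continuous f) (hg : Continuous g) {ε : ℝ}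
      (hfg : ∀ x ∈ Icc a b, |g x - f x| < ε) :
      |∫ x, g x ∂ρ - ∫ x, f x ∂ρ| ≤ ε * ρ.real univ := by
    rw [← integral_sub (integrable_of_continuous hρ hg) (integrable_of_continuous hρ hf)]
    rw [← Real.norm_eq_abs]
    refine norm_integral_le_of_norm_le_const (hρ.mono fun x hx => ?_)
    exact (hfg x hx).le
  refine ext_of_forall_integral_eq_of_IsFiniteMeasure fun f => ?_
  refine eq_of_abs_sub_nonpos (le_of_forall_pos_le_add fun δ hδ => ?_)
  set M := μ.real univ + ν.real univ + 1 with hM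
  have hM_pos : 0 < M := by positivity
  obtain ⟨p, hp⟩ := exists_polynomial_near_of_continuousOn a b f f.continuous.continuousOn
    (δ / M) (by positivity)
  have h₁ := abs_le.1 (integral_near hμ f.continuous p.continuous hp)
  have h₂ := abs_le.1 (integral_near hν f.continuous p.continuous hp)
  rw [integral_eval p] at h₁
  have h₃ : δ / M * μ.real univ + δ / M * ν.real univ + δ / M = δ := by
    field_simp
    rw [hM]
  have h₄ : 0 < δ / M := by positivity
  rw [abs_le]
  constructor <;> linarith

theorem ae_nonneg_invGammaLaw (ν : ℝ) : ∀ᵐ z ∂invGammaLaw ν, 0 ≤ z := by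
  rw [invGammaLaw, ae_map_iff (by fun_prop) measurableSet_Ici, gammaMeasure,
    ae_withDensity_iff (by unfold gammaPDF; fun_prop)]
  refine ae_of_all _ fun x hx => ?_
  have : 0 ≤ x := by
    by_contra! h
    exact hx (gammaPDF_of_neg h)
  positivity

/-- The inverse-gamma law charges every neighbourhood of `0`. -/
theorem not_ae_le_invGammaLaw {ν c : ℝ} (hν : 0 < ν) (hc : 0 < c) :
    ¬ ∀ᵐ z ∂invGammaLaw ν, c ≤ z := by
  rw [invGammaLaw, ae_map_iff (by fun_prop) measurableSet_Ici, gammaMeasure,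
    ae_withDensity_iff (by unfold gammaPDF; fun_prop)]
  intro h
  have hnull : volume (Ioi (1 / (2 * c))) = 0 := by
    refine measure_mono_null (fun x hx => ?_) (ae_iff.1 h)
    have hx' : 1 / (2 * c) < x := hx
    have hx₀ : 0 < x := lt_trans (by positivity) hx'
    simp only [mem_ofPred_eq, Classical.not_imp, not_le]
    refine ⟨(ENNReal.ofReal_pos.2 (gammaPDFReal_pos hν one_pos hx₀)).ne', ?_⟩
    rw [div_lt_iff₀ (by positivity)] at hx' ⊢
    linarith
  simp at hnull

theorem stmt8 {Ω : Type*} [MeasurableSpace Ω] (P : Measure Ω) [IsProbabilityMeasure P]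
    (ν b c : ℝ) (hν : 0 < ν) (hb : 0 < b) (hbc : b < c)
    (Z S₁ S₂ : Ω → ℝ) (hZm : Measurable Z) (hS₁m : Measurable S₁) (hS₂m : Measurable S₂)
    (hZ : Measure.map Z P = invGammaLaw ν)
    (hS₁ : ∀ᵐ ω ∂P, S₁ ω ∈ Set.Icc (0:ℝ) 1)
    (hS₂ : ∀ᵐ ω ∂P, S₂ ω ∈ Set.Icc (0:ℝ) 1)
    (hind₁ : IndepFun S₁ Z P) (hind₂ : IndepFun S₂ Z P)
    (hlaw₁ : Measure.map (fun ω => max (1 - Z ω / b) 0) P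
           = Measure.map (fun ω => S₁ ω * max (1 - Z ω / c) 0) P)
    (hlaw₂ : Measure.map (fun ω => max (1 - Z ω / b) 0) P
           = Measure.map (fun ω => S₂ ω * max (1 - Z ω / c) 0) P) :
    Measure.map S₁ P = Measure.map S₂ P := by
  have hc : 0 < c := hb.trans hbc
  have hZ_nonneg : ∀ᵐ ω ∂P, 0 ≤ Z ω :=
    ae_of_ae_map hZm.aemeasurable (hZ ▸ ae_nonneg_invGammaLaw ν)
  have hZ_small : ¬ ∀ᵐ ω ∂P, c ≤ Z ω := by
    rw [← ae_map_iff hZm.aemeasurable measurableSet_Ici, hZ]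
    exact not_ae_le_invGammaLaw hν hc
  have hpos (n : ℕ) : ∫ ω, max (1 - Z ω / c) 0 ^ n ∂P ≠ 0 := by
    have hint : Integrable (fun ω => max (1 - Z ω / c) 0 ^ n) P := by
      refine Integrable.of_bound (by fun_prop) 1 (hZ_nonneg.mono fun ω hω => ?_)
      have h₀ : 0 ≤ Z ω / c := by positivity
      rw [Real.norm_of_nonneg (by positivity)]
      exact pow_le_one₀ (le_max_right _ _) (max_le (by linarith) zero_le_one)
    intro h
    rw [integral_eq_zero_iff_of_nonneg (fun ω => by positivity) hint] at h
    refine hZ_small (h.mono fun ω hω => ?_)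
    have h₁ : max (1 - Z ω / c) 0 = 0 := eq_zero_of_pow_eq_zero hω
    have h₂ := max_eq_right_iff.1 h₁
    rwa [sub_nonpos, one_le_div hc] at h₂
  have hmoment {S : Ω → ℝ} (hSm : Measurable S) (hind : IndepFun S Z P)
      (hlaw : Measure.map (fun ω => max (1 - Z ω / b) 0) P
        = Measure.map (fun ω => S ω * max (1 - Z ω / c) 0) P) (n : ℕ) :
      (∫ x, x ^ n ∂P.map S) * ∫ ω, max (1 - Z ω / c) 0 ^ n ∂P
        = ∫ x, x ^ n ∂P.map (fun ω => max (1 - Z ω / b) 0) := by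
    rw [hlaw, integral_map hSm.aemeasurable (by fun_prop),
      integral_map (by fun_prop) (by fun_prop)]
    simp_rw [mul_pow]
    exact ((hind.comp (φ := fun x => x ^ n) (ψ := fun z => max (1 - z / c) 0 ^ n)
      (by fun_prop) (by fun_prop)).integral_fun_mul_eq_mul_integral
        (by fun_prop) (by fun_prop)).symm
  have : IsProbabilityMeasure (P.map S₁) := Measure.isProbabilityMeasure_map hS₁m.aemeasurable
  have : IsProbabilityMeasure (P.map S₂) := Measure.isProbabilityMeasure_map hS₂m.aemeasurable
  exact Measure.eq_of_forall_integral_pow_eq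
    ((ae_map_iff hS₁m.aemeasurable measurableSet_Icc).2 hS₁)
    ((ae_map_iff hS₂m.aemeasurable measurableSet_Icc).2 hS₂)
    fun n => mul_right_cancel₀ (hpos n)
      ((hmoment hS₁m hind₁ hlaw₁ n).trans (hmoment hS₂m hind₂ hlaw₂ n).symm)
end

section
/- Fix ν > 0 and 0 < b < c. Let Z be an inverse-gamma random variable, and let X₁ and X₂ be nonnegative random variables, each independent of Z, such that for i = 1,2 the random variables 1 + Z/b and (1 + Xᵢ/b)(1 + Z/c) have the same distribution. Then X₁ and X₂ have the same distribution. -/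
open MeasureTheory ProbabilityTheory Real Set

/-- Two bounded random variables with the same moments have the same law. -/
theorem map_eq_map_of_forall_moment_eq {Ω : Type*} [MeasurableSpace Ω] {P : Measure Ω}
    [IsProbabilityMeasure P] {U V : Ω → ℝ} {A B : ℝ} (hU : Measurable U) (hV : Measurable V)
    (hUb : ∀ᵐ ω ∂P, U ω ∈ Icc A B) (hVb : ∀ᵐ ω ∂P, V ω ∈ Icc A B)
    (hUV : ∀ n : ℕ, ∫ ω, U ω ^ n ∂P = ∫ ω, V ω ^ n ∂P) :
    Measure.map U P = Measure.map V P := by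
  have expSet_eq {W : Ω → ℝ} (hW : Measurable W) (hWb : ∀ᵐ ω ∂P, W ω ∈ Icc A B) :
      interior (integrableExpSet W P) = univ := by
    rw [eq_univ_of_forall (s := integrableExpSet W P)
      fun t => integrable_exp_mul_of_mem_Icc hW.aemeasurable hWb, interior_univ]
  have hU' := expSet_eq hU hUb
  have hV' := expSet_eq hV hVb
  have hmgf : mgf U P = mgf V P := by
    refine AnalyticOnNhd.eq_of_eventuallyEq (𝕜 := ℝ) (z₀ := 0)
      (hU' ▸ analyticOnNhd_mgf) (hV' ▸ analyticOnNhd_mgf) ?_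
    have sU := (hasFPowerSeriesAt_mgf (X := U) (μ := P) (v := 0)
      (hU' ▸ mem_univ _)).eventually_hasSum
    have sV := (hasFPowerSeriesAt_mgf (X := V) (μ := P) (v := 0)
      (hV' ▸ mem_univ _)).eventually_hasSum
    filter_upwards [sU, sV] with t htU htV
    simp only [zero_mul, Real.exp_zero, mul_one, zero_add, hUV] at htU htV
    exact htU.unique htV
  refine Measure.ext_of_complexMGF_eq hU.aemeasurable hV.aemeasurable ?_
  funext z
  exact eqOn_complexMGF_of_mgf hmgf (by simp [hU'])

/-- In the equation `Y =law U * W` with `U` and `W` independent and `W ≥ 1`, the inverse moments of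
`U` are determined by those of `Y` and `W`. -/
theorem integral_inv_pow_eq_div {Ω : Type*} [MeasurableSpace Ω] {P : Measure Ω}
    [IsProbabilityMeasure P] {Y U W : Ω → ℝ} (hY : Measurable Y) (hU : Measurable U)
    (hW : Measurable W) (hW1 : ∀ᵐ ω ∂P, 1 ≤ W ω) (hind : IndepFun U W P)
    (hlaw : Measure.map Y P = Measure.map (fun ω => U ω * W ω) P) (n : ℕ) :
    ∫ ω, (U ω)⁻¹ ^ n ∂P = (∫ ω, (Y ω)⁻¹ ^ n ∂P) / ∫ ω, (W ω)⁻¹ ^ n ∂P := by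
  have hmeas : Measurable fun y : ℝ => y⁻¹ ^ n := by fun_prop
  have hpos : 0 < ∫ ω, (W ω)⁻¹ ^ n ∂P := by
    have hb : ∀ᵐ ω ∂P, 0 < (W ω)⁻¹ ^ n ∧ (W ω)⁻¹ ^ n ≤ 1 := by
      filter_upwards [hW1] with ω h
      have h0 : 0 < (W ω)⁻¹ := inv_pos.mpr (by linarith)
      exact ⟨pow_pos h0 n, pow_le_one₀ h0.le (inv_le_one_of_one_le₀ h)⟩
    have hint : Integrable (fun ω => (W ω)⁻¹ ^ n) P := by
      refine .of_bound (by fun_prop) 1 ?_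
      filter_upwards [hb] with ω h
      rw [Real.norm_of_nonneg h.1.le]
      exact h.2
    rw [integral_pos_iff_support_of_nonneg_ae (hb.mono fun ω h => h.1.le) hint,
      measure_eq_measure_of_null_sdiff (subset_univ _) (by
        rw [← compl_eq_univ_sdiff]
        exact hb.mono fun ω h => Function.mem_support.mpr h.1.ne'), measure_univ]
    exact one_pos
  rw [eq_div_iff hpos.ne', ← integral_map hY.aemeasurable (f := fun y : ℝ => y⁻¹ ^ n)
    hmeas.aestronglyMeasurable, hlaw,
    integral_map (φ := fun ω => U ω * W ω) (by fun_prop) hmeas.aestronglyMeasurable,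
    ← hind.integral_fun_comp_mul_comp hU.aemeasurable hW.aemeasurable
      hmeas.aestronglyMeasurable hmeas.aestronglyMeasurable]
  simp only [mul_inv, mul_pow]

theorem stmt10 {Ω : Type*} [MeasurableSpace Ω] (P : Measure Ω) [IsProbabilityMeasure P]
    (ν b c : ℝ) (hν : 0 < ν) (hb : 0 < b) (hbc : b < c)
    (Z X₁ X₂ : Ω → ℝ) (hZm : Measurable Z) (hX₁m : Measurable X₁) (hX₂m : Measurable X₂)
    (hZ : Measure.map Z P = invGammaLaw ν)
    (hX₁ : ∀ᵐ ω ∂P, 0 ≤ X₁ ω) (hX₂ : ∀ᵐ ω ∂P, 0 ≤ X₂ ω)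
    (hind₁ : IndepFun X₁ Z P) (hind₂ : IndepFun X₂ Z P)
    (hlaw₁ : Measure.map (fun ω => 1 + Z ω / b) P
           = Measure.map (fun ω => (1 + X₁ ω / b) * (1 + Z ω / c)) P)
    (hlaw₂ : Measure.map (fun ω => 1 + Z ω / b) P
           = Measure.map (fun ω => (1 + X₂ ω / b) * (1 + Z ω / c)) P) :
    Measure.map X₁ P = Measure.map X₂ P := by
  have hc : 0 < c := hb.trans hbc
  have hZ0 : ∀ᵐ ω ∂P, 0 ≤ Z ω := ae_of_ae_map hZm.aemeasurable (hZ ▸ ae_nonneg_invGammaLaw ν)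
  have hW1 : ∀ᵐ ω ∂P, 1 ≤ 1 + Z ω / c := by
    filter_upwards [hZ0] with ω h
    exact le_add_of_nonneg_right (by positivity)
  have bounds {X : Ω → ℝ} (hX : ∀ᵐ ω ∂P, 0 ≤ X ω) :
      ∀ᵐ ω ∂P, (1 + X ω / b)⁻¹ ∈ Icc (0 : ℝ) 1 := by
    filter_upwards [hX] with ω h
    exact ⟨by positivity, inv_le_one_of_one_le₀ (le_add_of_nonneg_right (by positivity))⟩
  have hind {X : Ω → ℝ} (h : IndepFun X Z P) :
      IndepFun (fun ω => 1 + X ω / b) (fun ω => 1 + Z ω / c) P :=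
    h.comp (φ := fun x => 1 + x / b) (ψ := fun z => 1 + z / c) (by fun_prop) (by fun_prop)
  have hmap : Measure.map (fun ω => (1 + X₁ ω / b)⁻¹) P
      = Measure.map (fun ω => (1 + X₂ ω / b)⁻¹) P := by
    refine map_eq_map_of_forall_moment_eq (by fun_prop) (by fun_prop) (bounds hX₁) (bounds hX₂)
      fun n => ?_
    rw [integral_inv_pow_eq_div (by fun_prop) (by fun_prop) (by fun_prop) hW1 (hind hind₁) hlaw₁,
      integral_inv_pow_eq_div (by fun_prop) (by fun_prop) (by fun_prop) hW1 (hind hind₂) hlaw₂]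
  have recover {X : Ω → ℝ} (hX : Measurable X) : Measure.map X P
      = Measure.map (fun u => b * (u⁻¹ - 1)) (Measure.map (fun ω => (1 + X ω / b)⁻¹) P) := by
    rw [Measure.map_map (by fun_prop) (by fun_prop)]
    congr 1
    ext ω
    simp only [Function.comp_apply, inv_inv]
    field_simp
    ring
  rw [recover hX₁m, hmap, ← recover hX₂m]
end

section
/- Fix ν > 0 and b > c > 0. Let ζ be the inverse-gamma law with parameter ν, and for α > 0 let μ_α be the probability measure on (α,∞) defined by μ_α(dz) = (z−α)^{ν−1} 1_{z>α} ζ(dz) / N_α, where N_α = ∫_{(α,∞)} (z−α)^{ν−1} ζ(dz) (which is finite and positive). Let Z_b, Z_c be random variables with laws μ_b, μ_c respectively, and let Y be a random variable with values in (0,1], independent of Z_c, such that Z_b/b − 1 and Y·(Z_c/c − 1) have the same distribution. Then for every a with 0 < a < 1, E[Y^a] = (Φ(ν+a, ν+1; 1/(2b)) · Φ(ν, ν+1; 1/(2c))) / (Φ(ν, ν+1; 1/(2b)) · Φ(ν+a, ν+1; 1/(2c))). -/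
open MeasureTheory ProbabilityTheory Real Set

/-- The tilted inverse-gamma law `μ_α(dz) = (z−α)^{ν−1} 1_{z>α} ζ(dz) / N_α`, where `ζ`
is the inverse-gamma law with parameter `ν` and `N_α` is the normalizing constant. -/
noncomputable def tiltedInvGamma (ν α : ℝ) : Measure ℝ :=
  ((invGammaLaw ν).withDensity
      (fun z => ENNReal.ofReal (if α < z then (z - α) ^ (ν - 1) else 0)) Set.univ)⁻¹ •
    (invGammaLaw ν).withDensity
      (fun z => ENNReal.ofReal (if α < z then (z - α) ^ (ν - 1) else 0))

/-- The integrand of the Euler integral is integrable. -/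
lemma integrableOn_kummer {p q : ℝ} (hp : 0 < p) (hq : 0 < q) (z : ℝ) :
    IntegrableOn (fun t : ℝ => t ^ (p - 1) * (1 - t) ^ (q - 1) * Real.exp (z * t))
      (Set.Ioo 0 1) := by
  have h := Complex.betaIntegral_convergent (u := p) (v := q) (by simpa) (by simpa)
  rw [intervalIntegrable_iff_integrableOn_Icc_of_le zero_le_one] at h
  have hbeta : IntegrableOn (fun t : ℝ => t ^ (p - 1) * (1 - t) ^ (q - 1)) (Set.Icc 0 1) := by
    refine IntegrableOn.congr_fun h.re (fun x hx => ?_) measurableSet_Icc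
    norm_cast
    rw [← Complex.ofReal_cpow hx.1, ← Complex.ofReal_cpow (by linarith [hx.2]),
      RCLike.re_to_complex, Complex.re_mul_ofReal, Complex.ofReal_re]
  exact (hbeta.mul_continuousOn (by fun_prop) isCompact_Icc).mono_set Ioo_subset_Icc_self

lemma kummer_integral_pos_s11 {p q : ℝ} (hp : 0 < p) (hq : 0 < q) (z : ℝ) :
    0 < ∫ t in Set.Ioo (0:ℝ) 1, t ^ (p - 1) * (1 - t) ^ (q - 1) * Real.exp (z * t) := by
  have hpos : ∀ t ∈ Set.Ioo (0:ℝ) 1,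
      0 < t ^ (p - 1) * (1 - t) ^ (q - 1) * Real.exp (z * t) := fun t ht =>
    mul_pos (mul_pos (rpow_pos_of_pos ht.1 _) (rpow_pos_of_pos (sub_pos.2 ht.2) _)) (exp_pos _)
  rw [setIntegral_pos_iff_support_of_nonneg_ae
    (ae_restrict_of_forall_mem measurableSet_Ioo fun t ht => (hpos t ht).le)
    (integrableOn_kummer hp hq z)]
  refine lt_of_lt_of_le ?_ (measure_mono (s := Set.Ioo (0:ℝ) 1) fun t ht => ⟨(hpos t ht).ne', ht⟩)
  simp

lemma Phi_pos {α β : ℝ} (hα : 0 < α) (hαβ : α < β) (z : ℝ) : 0 < Phi α β z := by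
  have hβα : 0 < β - α := sub_pos.2 hαβ
  exact mul_pos (div_pos (Gamma_pos_of_pos (hα.trans hαβ))
    (mul_pos (Gamma_pos_of_pos hα) (Gamma_pos_of_pos hβα))) (kummer_integral_pos_s11 hα hβα z)

/-- The density `(z - α)^{ν-1} 1_{z > α}` is measurable. -/
lemma measurable_tilt (ν α : ℝ) :
    Measurable fun z : ℝ => if α < z then (z - α) ^ (ν - 1) else 0 :=
  Measurable.ite measurableSet_Ioi (by fun_prop) measurable_const

lemma tilt_nonneg (ν α z : ℝ) : 0 ≤ if α < z then (z - α) ^ (ν - 1) else 0 := by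
  split_ifs with h
  · exact rpow_nonneg (sub_pos.2 h).le _
  · exact le_rfl

/-- The integrand after the substitution `x = (1 - u) / (2α)`. -/
lemma gammaPDFReal_mul_tilt {ν α : ℝ} (hα : 0 < α) (a u : ℝ) :
    gammaPDFReal ν 1 ((2 * α)⁻¹ * (1 - u)) *
        ((if α < 1 / (2 * ((2 * α)⁻¹ * (1 - u))) then
            (1 / (2 * ((2 * α)⁻¹ * (1 - u))) - α) ^ (ν - 1) else 0) *
          (1 / (2 * ((2 * α)⁻¹ * (1 - u))) / α - 1) ^ a) =
      (Set.Ioo (0:ℝ) 1).indicator (fun u =>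
        ((Gamma ν)⁻¹ * (2⁻¹ : ℝ) ^ (ν - 1) * Real.exp (-(1 / (2 * α)))) *
          (u ^ (ν + a - 1) * (1 - u) ^ (ν + 1 - (ν + a) - 1) *
            Real.exp (1 / (2 * α) * u))) u := by
  have hz : 1 / (2 * ((2 * α)⁻¹ * (1 - u))) = α / (1 - u) := by
    rw [← mul_assoc, mul_inv, ← mul_assoc, mul_inv_cancel₀ two_ne_zero, one_mul, one_div,
      mul_inv, inv_inv, div_eq_mul_inv]
  rw [hz]
  by_cases hu1 : u < 1
  · have h1 : 0 < 1 - u := sub_pos.2 hu1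
    by_cases hu0 : 0 < u
    · rw [indicator_of_mem (show u ∈ Set.Ioo (0:ℝ) 1 from ⟨hu0, hu1⟩),
        if_pos (by rw [lt_div_iff₀ h1]; nlinarith), gammaPDFReal, if_pos (by positivity)]
      have e1 : α / (1 - u) - α = α * (u / (1 - u)) := by field_simp; ring
      have e2 : α / (1 - u) / α - 1 = u / (1 - u) := by field_simp; ring
      have e3 : Real.exp (-(1 * ((2 * α)⁻¹ * (1 - u)))) =
          Real.exp (-(1 / (2 * α))) * Real.exp (1 / (2 * α) * u) := by
        rw [← Real.exp_add]; congr 1; field_simp; ring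
      have e4 : ν + 1 - (ν + a) - 1 = -a := by ring
      have e5 : ν + a - 1 = (ν - 1) + a := by ring
      rw [e1, e2, e3, e4, e5, one_rpow, mul_rpow (by positivity) h1.le,
        mul_rpow hα.le (by positivity), div_rpow hu0.le h1.le, div_rpow hu0.le h1.le,
        rpow_add hu0, rpow_neg h1.le, mul_inv, mul_rpow (by positivity) (by positivity),
        inv_rpow hα.le]
      have := (rpow_pos_of_pos hα (ν - 1)).ne'
      have := (rpow_pos_of_pos h1 (ν - 1)).ne'
      have := (rpow_pos_of_pos h1 a).ne'
      field_simp
    · rw [indicator_of_notMem (fun h => hu0 h.1),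
        if_neg (by rw [lt_div_iff₀ h1]; nlinarith), zero_mul, mul_zero]
  · rw [indicator_of_notMem (fun h => hu1 h.2), if_neg, zero_mul, mul_zero]
    exact not_lt.2 ((div_nonpos_of_nonneg_of_nonpos hα.le (by linarith)).trans hα.le)

/-- Moments of `z / α - 1` under the unnormalized tilted law, as Euler integrals. -/
lemma integral_withDensity_tilt {ν α : ℝ} (hν : 0 < ν) (hα : 0 < α) (a : ℝ) :
    ∫ z, (z / α - 1) ^ a ∂((invGammaLaw ν).withDensity
        (fun z => ENNReal.ofReal (if α < z then (z - α) ^ (ν - 1) else 0))) =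
      ((2 * α)⁻¹ * ((Gamma ν)⁻¹ * (2⁻¹ : ℝ) ^ (ν - 1) * Real.exp (-(1 / (2 * α))))) *
        ∫ u in Set.Ioo (0:ℝ) 1, u ^ (ν + a - 1) * (1 - u) ^ (ν + 1 - (ν + a) - 1) *
          Real.exp (1 / (2 * α) * u) := by
  have hm := measurable_tilt ν α
  rw [integral_withDensity_eq_integral_toReal_smul hm.ennreal_ofReal (by simp), invGammaLaw,
    integral_map (by fun_prop) (by
      refine Measurable.aestronglyMeasurable ?_
      exact hm.ennreal_ofReal.ennreal_toReal.smul (by fun_prop)),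
    gammaMeasure, integral_withDensity_eq_integral_toReal_smul
      (f := gammaPDF ν 1) (measurable_gammaPDFReal ν 1).ennreal_ofReal (by simp [gammaPDF])]
  simp only [gammaPDF, ENNReal.toReal_ofReal (tilt_nonneg ν α _),
    ENNReal.toReal_ofReal (gammaPDFReal_nonneg hν one_pos _), smul_eq_mul]
  set h : ℝ → ℝ := fun x => gammaPDFReal ν 1 x *
    ((if α < 1 / (2 * x) then (1 / (2 * x) - α) ^ (ν - 1) else 0) *
      (1 / (2 * x) / α - 1) ^ a) with hh
  have hsub : ∫ x, h x = (2 * α)⁻¹ * ∫ u, h ((2 * α)⁻¹ * (1 - u)) := by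
    rw [integral_sub_left_eq_self (fun u => h ((2 * α)⁻¹ * u)) volume 1,
      Measure.integral_comp_mul_left, inv_inv, abs_of_pos (by positivity), smul_eq_mul,
      ← mul_assoc, inv_mul_cancel₀ (by positivity), one_mul]
  rw [hsub, hh]
  simp only [gammaPDFReal_mul_tilt hα]
  rw [integral_indicator measurableSet_Ioo, integral_const_mul, ← mul_assoc]

/-- Moments of `z / α - 1` under the tilted inverse-gamma law. -/
lemma integral_tiltedInvGamma {ν α a : ℝ} (hν : 0 < ν) (hα : 0 < α) (ha0 : 0 < a)
    (ha1 : a < 1) :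
    ∫ z, (z / α - 1) ^ a ∂(tiltedInvGamma ν α) =
      Gamma (ν + a) * Gamma (1 - a) / Gamma ν *
        (Phi (ν + a) (ν + 1) (1 / (2 * α)) / Phi ν (ν + 1) (1 / (2 * α))) := by
  have hmass := integral_withDensity_tilt hν hα 0
  simp only [rpow_zero, integral_const, smul_eq_mul, mul_one, add_zero, measureReal_def] at hmass
  rw [tiltedInvGamma, integral_smul_measure, ENNReal.toReal_inv, hmass,
    integral_withDensity_tilt hν hα a, Phi, Phi, smul_eq_mul,
    show ν + 1 - (ν + a) = 1 - a by ring, show ν + 1 - ν = 1 by ring, Gamma_one]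
  have hJ := (kummer_integral_pos_s11 hν one_pos (1 / (2 * α))).ne'
  have := (Gamma_pos_of_pos hν).ne'
  have := (Gamma_pos_of_pos (show 0 < ν + 1 by linarith)).ne'
  have := (Gamma_pos_of_pos (show 0 < ν + a by linarith)).ne'
  have := (Gamma_pos_of_pos (show 0 < 1 - a by linarith)).ne'
  have := (rpow_pos_of_pos (show (0:ℝ) < 2⁻¹ by norm_num) (ν - 1)).ne'
  have := Real.exp_ne_zero (-(1 / (2 * α)))
  generalize (∫ u in Set.Ioo (0:ℝ) 1, u ^ (ν - 1) * (1 - u) ^ ((1:ℝ) - 1) *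
    Real.exp (1 / (2 * α) * u)) = J at *
  generalize Real.exp (-(1 / (2 * α))) = E at *
  generalize (2⁻¹ : ℝ) ^ (ν - 1) = F at *
  field_simp

lemma ae_lt_tiltedInvGamma (ν α : ℝ) : ∀ᵐ z ∂(tiltedInvGamma ν α), α < z := by
  refine Measure.ae_smul_measure ?_ _
  rw [ae_withDensity_iff (measurable_tilt ν α).ennreal_ofReal]
  refine Filter.Eventually.of_forall fun z hz => ?_
  by_contra h
  simp [h] at hz

theorem stmt11 {Ω : Type*} [MeasurableSpace Ω] (P : Measure Ω) [IsProbabilityMeasure P]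
    (ν b c : ℝ) (hν : 0 < ν) (hc : 0 < c) (hcb : c < b)
    (Zb Zc Y : Ω → ℝ) (hZbm : Measurable Zb) (hZcm : Measurable Zc) (hYm : Measurable Y)
    (hZb : Measure.map Zb P = tiltedInvGamma ν b)
    (hZc : Measure.map Zc P = tiltedInvGamma ν c)
    (hY : ∀ᵐ ω ∂P, Y ω ∈ Set.Ioc (0:ℝ) 1)
    (hind : IndepFun Y Zc P)
    (hlaw : Measure.map (fun ω => Zb ω / b - 1) P
          = Measure.map (fun ω => Y ω * (Zc ω / c - 1)) P) :
    ∀ a : ℝ, 0 < a → a < 1 →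
      (∫ ω, Y ω ^ a ∂P)
        = (Phi (ν + a) (ν + 1) (1 / (2 * b)) * Phi ν (ν + 1) (1 / (2 * c))) /
          (Phi ν (ν + 1) (1 / (2 * b)) * Phi (ν + a) (ν + 1) (1 / (2 * c))) := by
  intro a ha0 ha1
  have hb : 0 < b := hc.trans hcb
  have hmom : ∀ (Z : Ω → ℝ) (α : ℝ), Measurable Z → Measure.map Z P = tiltedInvGamma ν α →
      0 < α → ∫ ω, (Z ω / α - 1) ^ a ∂P = Gamma (ν + a) * Gamma (1 - a) / Gamma ν *
        (Phi (ν + a) (ν + 1) (1 / (2 * α)) / Phi ν (ν + 1) (1 / (2 * α))) := by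
    intro Z α hZ hZlaw hα
    rw [← integral_tiltedInvGamma hν hα ha0 ha1, ← hZlaw, integral_map hZ.aemeasurable
      (by exact Measurable.aestronglyMeasurable (by fun_prop))]
  have hZc_gt : ∀ᵐ ω ∂P, c < Zc ω :=
    ae_of_ae_map hZcm.aemeasurable (hZc ▸ ae_lt_tiltedInvGamma ν c)
  have hrpow : Measurable fun x : ℝ => x ^ a := by fun_prop
  have hprod : ∫ ω, (Zb ω / b - 1) ^ a ∂P = ∫ ω, (Y ω * (Zc ω / c - 1)) ^ a ∂P := by
    rw [← integral_map (φ := fun ω => Zb ω / b - 1) (f := fun x : ℝ => x ^ a)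
        (by fun_prop) hrpow.aestronglyMeasurable, hlaw,
      integral_map (by fun_prop) hrpow.aestronglyMeasurable]
  have hsplit : ∫ ω, (Y ω * (Zc ω / c - 1)) ^ a ∂P =
      (∫ ω, Y ω ^ a ∂P) * ∫ ω, (Zc ω / c - 1) ^ a ∂P := by
    have hind' := hind.comp (φ := fun y : ℝ => y ^ a) (ψ := fun z : ℝ => (z / c - 1) ^ a)
      hrpow (by fun_prop)
    refine Eq.trans (integral_congr_ae ?_) (hind'.integral_fun_mul_eq_mul_integral
      (hrpow.comp hYm).aestronglyMeasurable
      (Measurable.aestronglyMeasurable (by fun_prop)))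
    filter_upwards [hY, hZc_gt] with ω h1 h2
    have h3 : 0 ≤ Zc ω / c - 1 := by
      rw [sub_nonneg, one_le_div hc]; exact h2.le
    exact mul_rpow h1.1.le h3
  rw [hsplit, hmom Zb b hZbm hZb hb, hmom Zc c hZcm hZc hc] at hprod
  have := (Gamma_pos_of_pos hν).ne'
  have := (Gamma_pos_of_pos (show 0 < ν + a by linarith)).ne'
  have := (Gamma_pos_of_pos (show 0 < 1 - a by linarith)).ne'
  have := (Phi_pos hν (lt_add_one ν) (1 / (2 * b))).ne'
  have := (Phi_pos hν (lt_add_one ν) (1 / (2 * c))).ne'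
  have := (Phi_pos (show 0 < ν + a by linarith) (show ν + a < ν + 1 by linarith)
    (1 / (2 * c))).ne'
  generalize Phi (ν + a) (ν + 1) (1 / (2 * b)) = A at *
  generalize Phi (ν + a) (ν + 1) (1 / (2 * c)) = B at *
  generalize Phi ν (ν + 1) (1 / (2 * b)) = C at *
  generalize Phi ν (ν + 1) (1 / (2 * c)) = D at *
  field_simp at hprod ⊢
  linarith
end

section
/- Fix ν > 0 and b > c > 0. There exist a probability space carrying an inverse-gamma random variable Z (with parameter ν) and a random variable S with values in [0,1], independent of Z, such that (Z/b − 1)_+ and S·(Z/c − 1)_+ have the same distribution. -/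
open MeasureTheory ProbabilityTheory Real Set

open Filter Topology
open scoped unitInterval ENNReal

/-- `f` is a mixture of the contractions `w ↦ g (w * x)`, `x ∈ [0,1]`, on `[0,∞)`. -/
def IsScaleMixture (f g : ℝ → ℝ) : Prop :=
  ∃ θ : ProbabilityMeasure I, ∀ w, 0 ≤ w → f w = ∫ x : I, g (w * x) ∂(θ : Measure I)

lemma continuous_comp_mul_unitInterval {g : ℝ → ℝ} (hg : ContinuousOn g (Ici 0)) {w : ℝ}
    (hw : 0 ≤ w) : Continuous fun x : I => g (w * x) :=
  hg.comp_continuous (by fun_prop) fun x => mul_nonneg hw x.2.1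

lemma integrable_unitInterval_of_continuous {φ : I → ℝ} (hφ : Continuous φ) (μ : Measure I)
    [IsFiniteMeasure μ] : Integrable φ μ :=
  hφ.integrable_of_hasCompactSupport (HasCompactSupport.of_compactSpace φ)

lemma integral_mconv_unitInterval {φ : I → ℝ} (hφ : Continuous φ) (μ ν : Measure I)
    [IsProbabilityMeasure μ] [IsProbabilityMeasure ν] :
    ∫ x, φ x ∂(μ ∗ₘ ν) = ∫ x, ∫ y, φ (x * y) ∂ν ∂μ :=
  integral_mconv (integrable_unitInterval_of_continuous hφ _)

lemma IsScaleMixture.refl (f : ℝ → ℝ) : IsScaleMixture f f :=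
  ⟨⟨Measure.dirac 1, inferInstance⟩, fun w _ => by simp⟩

lemma IsScaleMixture.trans {f g h : ℝ → ℝ} (hh : ContinuousOn h (Ici 0))
    (hfg : IsScaleMixture f g) (hgh : IsScaleMixture g h) : IsScaleMixture f h := by
  obtain ⟨θ, hθ⟩ := hfg
  obtain ⟨ρ, hρ⟩ := hgh
  refine ⟨⟨(θ : Measure I) ∗ₘ (ρ : Measure I), inferInstance⟩, fun w hw => ?_⟩
  rw [ProbabilityMeasure.coe_mk,
    integral_mconv_unitInterval (continuous_comp_mul_unitInterval hh hw), hθ w hw]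
  congr 1 with x
  rw [hρ _ (mul_nonneg hw x.2.1)]
  simp [mul_assoc]

lemma IsScaleMixture.of_tendsto {f g : ℝ → ℝ} (hg : ContinuousOn g (Ici 0))
    (θ : ℕ → ProbabilityMeasure I)
    (hθ : ∀ w, 0 ≤ w →
      Tendsto (fun k => ∫ x : I, g (w * x) ∂(θ k : Measure I)) atTop (𝓝 (f w))) :
    IsScaleMixture f g := by
  let u : Ultrafilter (ProbabilityMeasure I) := (hyperfilter ℕ).map θ
  have hu : (u : Filter _) ≤ 𝓝 u.lim := u.le_nhds_lim
  have ht : Tendsto θ (hyperfilter ℕ) (𝓝 u.lim) := hu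
  rw [ProbabilityMeasure.tendsto_iff_forall_integral_tendsto] at ht
  refine ⟨u.lim, fun w hw => ?_⟩
  refine tendsto_nhds_unique ((hθ w hw).mono_left ?_)
    (ht (BoundedContinuousFunction.mkOfCompact ⟨_, continuous_comp_mul_unitInterval hg hw⟩))
  rw [← Nat.cofinite_eq_atTop]
  exact hyperfilter_le_cofinite

lemma isScaleMixture_of_convexCombination {f g h : ℝ → ℝ} {a M : ℝ} (ha : 0 < a) (ha1 : a ≤ 1)
    (hf : ContinuousOn f (Ici 0)) (hg : ContinuousOn g (Ici 0))
    (hfM : ∀ w, 0 ≤ w → |f w| ≤ M) (hgM : ∀ w, 0 ≤ w → |g w| ≤ M)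
    (hhf : IsScaleMixture h f)
    (B : ProbabilityMeasure I)
    (hB : ∀ w, 0 ≤ w → f w = a * (∫ x : I, g (w * x) ∂(B : Measure I))
      + (1 - a) * ∫ x : I, h (w * x) ∂(B : Measure I)) :
    IsScaleMixture f g := by
  obtain ⟨τ, hτ⟩ := hhf
  set κ : Measure I := (B : Measure I) ∗ₘ (τ : Measure I) with hκ
  have hB' : ∀ w, 0 ≤ w → f w = a * (∫ x : I, g (w * x) ∂(B : Measure I))
      + (1 - a) * ∫ x : I, f (w * x) ∂κ := by
    intro w hw
    rw [hB w hw, hκ, integral_mconv_unitInterval (continuous_comp_mul_unitInterval hf hw)]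
    congr 3 with x
    rw [hτ _ (mul_nonneg hw x.2.1)]
    simp [mul_assoc]
  have key : ∀ J : ℕ, ∃ θ : ProbabilityMeasure I, ∀ w, 0 ≤ w →
      |f w - ∫ x : I, g (w * x) ∂(θ : Measure I)| ≤ (1 - a) ^ J * (M + M) := by
    intro J
    induction J with
    | zero =>
      refine ⟨⟨Measure.dirac 1, inferInstance⟩, fun w hw => ?_⟩
      simp only [ProbabilityMeasure.coe_mk, integral_dirac, pow_zero, one_mul]
      exact (abs_sub _ _).trans (add_le_add (hfM w hw) (hgM _ (by simpa using hw)))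
    | succ J ih =>
      obtain ⟨θ, hθ⟩ := ih
      have hprob : IsProbabilityMeasure (ENNReal.ofReal a • (B : Measure I)
          + ENNReal.ofReal (1 - a) • (κ ∗ₘ (θ : Measure I))) := by
        constructor
        simp [← ENNReal.ofReal_add ha.le (sub_nonneg.2 ha1)]
      refine ⟨⟨_, hprob⟩, fun w hw => ?_⟩
      have hgw := continuous_comp_mul_unitInterval hg hw
      rw [ProbabilityMeasure.coe_mk, integral_add_measure
        ((integrable_unitInterval_of_continuous hgw _).smul_measure ENNReal.ofReal_ne_top)
        ((integrable_unitInterval_of_continuous hgw _).smul_measure ENNReal.ofReal_ne_top),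
        integral_smul_measure, integral_smul_measure, ENNReal.toReal_ofReal ha.le,
        ENNReal.toReal_ofReal (sub_nonneg.2 ha1), integral_mconv_unitInterval hgw, hB' w hw]
      have hfi := integrable_unitInterval_of_continuous
        (continuous_comp_mul_unitInterval hf hw) κ
      have hgi : Integrable (fun x : I => ∫ y : I, g (w * (x * y : I)) ∂(θ : Measure I)) κ := by
        refine Integrable.integral_prod_left (f := fun z : I × I => g (w * (z.1 * z.2 : I))) ?_
        exact (hgw.comp (continuous_fst.mul continuous_snd)).integrable_of_hasCompactSupport
          (HasCompactSupport.of_compactSpace _)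
      rw [smul_eq_mul, smul_eq_mul, add_sub_add_left_eq_sub, ← mul_sub, ← integral_sub hfi hgi,
        abs_mul, abs_of_nonneg (sub_nonneg.2 ha1), pow_succ', mul_assoc]
      refine mul_le_mul_of_nonneg_left ?_ (sub_nonneg.2 ha1)
      have hle : ∀ x : I, ‖f (w * x) - ∫ y : I, g (w * (x * y : I)) ∂(θ : Measure I)‖
          ≤ (1 - a) ^ J * (M + M) := fun x => by
        simpa [mul_assoc] using hθ _ (mul_nonneg hw x.2.1)
      simpa using norm_integral_le_of_norm_le_const (μ := κ) (Eventually.of_forall hle)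
  choose θ hθ using key
  refine .of_tendsto hg θ fun w hw => ?_
  rw [tendsto_iff_norm_sub_tendsto_zero]
  have hlim : Tendsto (fun J : ℕ => (1 - a) ^ J * (M + M)) atTop (𝓝 0) := by
    simpa using (tendsto_pow_atTop_nhds_zero_of_lt_one (sub_nonneg.2 ha1)
      (by linarith : 1 - a < 1)).mul_const (M + M)
  refine squeeze_zero (fun _ => norm_nonneg _) (fun J => ?_) hlim
  rw [Real.norm_eq_abs, abs_sub_comm]
  exact hθ J w hw

lemma exists_powerLaw {A : ℝ} (hA : 1 ≤ A) :
    ∃ B : ProbabilityMeasure I, ∀ φ : ℝ → ℝ,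
      ∫ x : I, φ x ∂(B : Measure I) = ∫ x in (0 : ℝ)..1, A * x ^ (A - 1) * φ x := by
  have hnn : ∀ x : I, 0 ≤ A * (x : ℝ) ^ (A - 1) := fun x =>
    mul_nonneg (by linarith) (Real.rpow_nonneg x.2.1 _)
  have hcont : Continuous fun x : I => A * (x : ℝ) ^ (A - 1) :=
    continuous_const.mul
      ((Real.continuous_rpow_const (sub_nonneg.2 hA)).comp continuous_subtype_val)
  have hI : ∀ φ : ℝ → ℝ, ∫ x : I, φ x = ∫ x in (0 : ℝ)..1, φ x := fun φ => by
    rw [intervalIntegral.integral_of_le zero_le_one, ← integral_Icc_eq_integral_Ioc]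
    exact integral_subtype_comap (μ := volume) (s := I) measurableSet_Icc φ
  have hprob : IsProbabilityMeasure
      ((volume : Measure I).withDensity fun x => ENNReal.ofReal (A * (x : ℝ) ^ (A - 1))) := by
    constructor
    rw [withDensity_apply _ MeasurableSet.univ, setLIntegral_univ,
      ← ofReal_integral_eq_lintegral_ofReal (integrable_unitInterval_of_continuous hcont _)
        (Eventually.of_forall hnn), hI fun x => A * x ^ (A - 1),
      intervalIntegral.integral_const_mul, integral_rpow (Or.inl (by linarith))]
    rw [sub_add_cancel, Real.one_rpow, Real.zero_rpow (by linarith)]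
    field_simp
    simp
  refine ⟨⟨_, hprob⟩, fun φ => ?_⟩
  rw [ProbabilityMeasure.coe_mk, ← hI fun x => A * x ^ (A - 1) * φ x,
    integral_withDensity_eq_integral_toReal_smul (by fun_prop) (by simp)]
  simp [ENNReal.toReal_ofReal (hnn _)]

/-- The profile `(w/(1+w))^β (1 + ε/(1+w))^n`, an approximation to `(w/(1+w))^β e^{nε/(1+w)}`
which satisfies a first-order difference-differential equation. -/
noncomputable def profile (β ε : ℝ) (n : ℕ) (w : ℝ) : ℝ :=
  (w / (1 + w)) ^ β * (1 + ε / (1 + w)) ^ n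

lemma continuousOn_profile {β : ℝ} (hβ : 0 ≤ β) (ε : ℝ) (n : ℕ) :
    ContinuousOn (profile β ε n) (Ici 0) := by
  unfold profile
  have h : ∀ w ∈ Ici (0 : ℝ), 1 + w ≠ 0 := fun w hw => by
    have : (0 : ℝ) ≤ w := hw
    positivity
  refine ContinuousOn.mul ?_ ?_
  · exact ContinuousOn.rpow_const (by fun_prop (disch := assumption)) fun _ _ => Or.inr hβ
  · fun_prop (disch := assumption)

lemma abs_profile_le {β ε : ℝ} (hβ : 0 ≤ β) (hε : 0 ≤ ε) (n : ℕ) {w : ℝ} (hw : 0 ≤ w) :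
    |profile β ε n w| ≤ (1 + ε) ^ n := by
  have h1 : 0 ≤ w / (1 + w) := by positivity
  have h2 : w / (1 + w) ≤ 1 := div_le_one_of_le₀ (by linarith) (by linarith)
  have h3 : ε / (1 + w) ≤ ε := div_le_self hε (by linarith)
  have h4 : 0 ≤ ε / (1 + w) := by positivity
  rw [profile, abs_of_nonneg (by positivity), ← one_mul ((1 + ε) ^ n)]
  gcongr
  exact Real.rpow_le_one h1 h2 hβ

lemma profile_zero {β : ℝ} (hβ : 0 < β) (ε : ℝ) (n : ℕ) : profile β ε n 0 = 0 := by
  simp [profile, Real.zero_rpow hβ.ne']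

lemma hasDerivAt_profile (β : ℝ) {N : ℝ} (hN : 0 < N) (n : ℕ) {w : ℝ} (hw : 0 < w) :
    HasDerivAt (profile β N⁻¹ n)
      ((N * (n + β) * profile β N⁻¹ (n + 1) w
        - (N * (n + β) + (N + 1) * n) * profile β N⁻¹ n w
        + (N + 1) * n * profile β N⁻¹ (n - 1) w) / w) w := by
  have hw1 : 1 + w ≠ 0 := by positivity
  have hv : 0 < w / (1 + w) := by positivity
  have d0 : HasDerivAt (fun w : ℝ => 1 + w) 1 w := by
    simpa using (hasDerivAt_id w).const_add 1
  have d1 := ((hasDerivAt_id w).div d0 hw1).rpow_const (p := β) (Or.inl hv.ne')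
  have d2 := ((((hasDerivAt_const w N⁻¹).div d0 hw1).const_add 1)).pow n
  refine (d1.mul d2).congr_deriv ?_
  simp only [profile, id, Pi.div_apply, Pi.pow_apply]
  rw [Real.rpow_sub_one hv.ne']
  set P := (w / (1 + w)) ^ β
  rcases n with _ | k
  · simp
    field_simp
    ring
  · simp only [Nat.add_sub_cancel, Nat.cast_add, Nat.cast_one, pow_succ]
    set Q := (1 + N⁻¹ / (1 + w)) ^ k
    field_simp
    ring

lemma profile_eq_integral {β N : ℝ} (hβ : 1 ≤ β) (hN : 1 ≤ N) (n : ℕ) {w : ℝ} (hw : 0 ≤ w) :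
    profile β N⁻¹ n w = ∫ x in (0 : ℝ)..1, x ^ (N * (n + β) + (N + 1) * n - 1) *
      (N * (n + β) * profile β N⁻¹ (n + 1) (w * x)
        + (N + 1) * n * profile β N⁻¹ (n - 1) (w * x)) := by
  rcases hw.eq_or_lt with rfl | hw
  · simp [profile_zero (by linarith : 0 < β)]
  set A := N * (n + β) + (N + 1) * n with hA
  have hn : (0 : ℝ) ≤ n := n.cast_nonneg
  have hA1 : 1 ≤ A := by nlinarith
  have hc : ∀ k, ContinuousOn (fun x => profile β N⁻¹ k (w * x)) (Icc 0 1) := fun k =>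
    (continuousOn_profile (by linarith) _ k).comp (by fun_prop) fun x hx =>
      mul_nonneg hw.le hx.1
  have hd : ∀ x ∈ Ioo (0 : ℝ) 1, HasDerivAt (fun x => x ^ A * profile β N⁻¹ n (w * x))
      (x ^ (A - 1) * (N * (n + β) * profile β N⁻¹ (n + 1) (w * x)
        + (N + 1) * n * profile β N⁻¹ (n - 1) (w * x))) x := by
    intro x hx
    have e1 := Real.hasDerivAt_rpow_const (p := A) (Or.inl hx.1.ne')
    have e2 : HasDerivAt (fun x => w * x) w x := by simpa using (hasDerivAt_id x).const_mul w
    have e3 := (hasDerivAt_profile β (by linarith : 0 < N) n (mul_pos hw hx.1)).comp x e2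
    refine (e1.mul e3).congr_deriv ?_
    have hx0 := hx.1.ne'
    rw [Real.rpow_sub_one hx0]
    simp only [Function.comp]
    field_simp
    ring
  rw [intervalIntegral.integral_eq_sub_of_hasDerivAt_of_le zero_le_one _ hd]
  · simp [Real.zero_rpow (by linarith : A ≠ 0)]
  · refine ContinuousOn.intervalIntegrable ?_
    rw [uIcc_of_le zero_le_one]
    exact (Real.continuous_rpow_const (by linarith)).continuousOn.mul
      ((continuousOn_const.mul (hc _)).add (continuousOn_const.mul (hc _)))
  · exact (Real.continuous_rpow_const (by linarith)).continuousOn.mul (hc _)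

lemma isScaleMixture_profile_succ {β N : ℝ} (hβ : 1 ≤ β) (hN : 1 ≤ N) (n : ℕ) :
    IsScaleMixture (profile β N⁻¹ n) (profile β N⁻¹ (n + 1)) := by
  have hε : 0 ≤ N⁻¹ := by positivity
  have hn0 : ∀ n : ℕ, (0 : ℝ) ≤ n := fun n => n.cast_nonneg
  have hcβ := fun k => continuousOn_profile (by linarith : 0 ≤ β) N⁻¹ k
  suffices key : ∀ n : ℕ, ∀ h : ℝ → ℝ, IsScaleMixture h (profile β N⁻¹ n) →
      ((n : ℝ) = 0 ∨ h = profile β N⁻¹ (n - 1)) →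
      IsScaleMixture (profile β N⁻¹ n) (profile β N⁻¹ (n + 1)) by
    induction n with
    | zero => exact key 0 _ (.refl _) (Or.inl (by simp))
    | succ n ih => exact key (n + 1) _ ih (Or.inr (by simp))
  intro n h hh hn
  set A := N * (n + β) + (N + 1) * n with hA
  have hnn := hn0 n
  have hl : 0 < N * (n + β) := by positivity
  have hA1 : 1 ≤ A := by nlinarith
  obtain ⟨B, hB⟩ := exists_powerLaw hA1
  refine isScaleMixture_of_convexCombination (a := N * (n + β) / A) (M := (1 + N⁻¹) ^ (n + 1))
    (by positivity) ((div_le_one (by linarith)).2 (by rw [hA]; nlinarith)) (hcβ _) (hcβ _)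
    (fun w hw => (abs_profile_le (by linarith) hε _ hw).trans
      (pow_le_pow_right₀ (by linarith) (by simp)))
    (fun w hw => abs_profile_le (by linarith) hε _ hw) hh B fun w hw => ?_
  have hA0 : A ≠ 0 := by linarith
  have ha : 1 - N * (n + β) / A = (N + 1) * n / A := by
    rw [hA] at hA0 ⊢; field_simp; ring
  rw [ha]
  have hc : ∀ k, ContinuousOn (fun x => profile β N⁻¹ k (w * x)) (Icc 0 1) := fun k =>
    (hcβ k).comp (by fun_prop) fun x hx => mul_nonneg hw hx.1
  have hii : ∀ k (c : ℝ), IntervalIntegrable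
      (fun x => c * (A * x ^ (A - 1) * profile β N⁻¹ k (w * x))) volume 0 1 := fun k c => by
    refine ContinuousOn.intervalIntegrable ?_
    rw [uIcc_of_le zero_le_one]
    exact continuousOn_const.mul
      ((continuous_const.mul (Real.continuous_rpow_const (by linarith))).continuousOn.mul (hc _))
  have hlast : (N + 1) * n / A * ∫ x : I, h (w * x) ∂(B : Measure I)
      = (N + 1) * n / A * ∫ x : I, profile β N⁻¹ (n - 1) (w * x) ∂(B : Measure I) := by
    rcases hn with hn | rfl
    · simp [hn]
    · rfl
  rw [hlast, hB fun x => profile β N⁻¹ (n + 1) (w * x), hB fun x => profile β N⁻¹ (n - 1) (w * x),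
    ← intervalIntegral.integral_const_mul, ← intervalIntegral.integral_const_mul,
    ← intervalIntegral.integral_add (hii _ _) (hii _ _), profile_eq_integral hβ hN n hw,
    ← hA]
  congr 1 with x
  field_simp

lemma isScaleMixture_profile {β N : ℝ} (hβ : 1 ≤ β) (hN : 1 ≤ N) {m n : ℕ} (hmn : m ≤ n) :
    IsScaleMixture (profile β N⁻¹ m) (profile β N⁻¹ n) := by
  induction n, hmn using Nat.le_induction with
  | base => exact .refl _
  | succ n _ ih =>
    exact ih.trans (continuousOn_profile (by linarith) _ _) (isScaleMixture_profile_succ hβ hN n)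

/-- The confluent profile `(w/(1+w))^β e^{p/(1+w)}`. -/
noncomputable def expProfile (β p w : ℝ) : ℝ := (w / (1 + w)) ^ β * Real.exp (p / (1 + w))

lemma continuousOn_expProfile {β : ℝ} (hβ : 0 ≤ β) (p : ℝ) :
    ContinuousOn (expProfile β p) (Ici 0) := by
  unfold expProfile
  have h : ∀ w ∈ Ici (0 : ℝ), 1 + w ≠ 0 := fun w hw => by
    have : (0 : ℝ) ≤ w := hw
    positivity
  refine ContinuousOn.mul ?_ ?_
  · exact ContinuousOn.rpow_const (by fun_prop (disch := assumption)) fun _ _ => Or.inr hβ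
  · fun_prop (disch := assumption)

lemma abs_expProfile_le {β p : ℝ} (hβ : 0 ≤ β) (hp : 0 ≤ p) {w : ℝ} (hw : 0 ≤ w) :
    |expProfile β p w| ≤ Real.exp p := by
  have h1 : 0 ≤ w / (1 + w) := by positivity
  have h2 : w / (1 + w) ≤ 1 := div_le_one_of_le₀ (by linarith) (by linarith)
  have h3 : p / (1 + w) ≤ p := div_le_self hp (by linarith)
  rw [expProfile, abs_of_nonneg (by positivity), ← one_mul (Real.exp p)]
  gcongr
  exact Real.rpow_le_one h1 h2 hβ

lemma abs_one_add_pow_sub_exp_le {p t N : ℝ} (hp : 0 ≤ p) (ht : 0 ≤ t) (ht1 : t ≤ 1)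
    (hN : 0 < N) :
    |(1 + N⁻¹ * t) ^ ⌊p * N⌋₊ - Real.exp (p * t)| ≤ Real.exp p * ((1 + p) * N⁻¹) := by
  set n := ⌊p * N⌋₊
  have hNi : 0 < N⁻¹ := by positivity
  have hn1 : (n : ℝ) * N⁻¹ ≤ p := by
    rw [← div_eq_mul_inv, div_le_iff₀ hN]
    exact Nat.floor_le (by positivity)
  have hn2 : p - N⁻¹ ≤ (n : ℝ) * N⁻¹ := by
    have := (Nat.lt_floor_add_one (p * N)).le
    have h := mul_le_mul_of_nonneg_right this hNi.le
    rw [mul_assoc, mul_inv_cancel₀ hN.ne', mul_one] at h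
    change p ≤ ((n : ℝ) + 1) * N⁻¹ at h
    linarith
  have hx : 0 ≤ N⁻¹ * t := by positivity
  set s := (n : ℝ) * Real.log (1 + N⁻¹ * t)
  have hs : (1 + N⁻¹ * t) ^ n = Real.exp s := by
    rw [Real.exp_nat_mul, Real.exp_log (by linarith)]
  have hs1 : s ≤ p * t := by
    have h1 : Real.log (1 + N⁻¹ * t) ≤ N⁻¹ * t := by
      linarith [Real.log_le_sub_one_of_pos (by linarith : 0 < 1 + N⁻¹ * t)]
    calc s ≤ n * (N⁻¹ * t) := mul_le_mul_of_nonneg_left h1 n.cast_nonneg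
      _ = (n * N⁻¹) * t := by ring
      _ ≤ p * t := by gcongr
  have hs2 : p * t - (1 + p) * N⁻¹ ≤ s := by
    have h1 : N⁻¹ * t - (N⁻¹ * t) ^ 2 ≤ Real.log (1 + N⁻¹ * t) := by
      refine le_trans ?_ (Real.one_sub_inv_le_log_of_pos (by linarith : 0 < 1 + N⁻¹ * t))
      rw [← sub_nonneg]
      have : 1 - (1 + N⁻¹ * t)⁻¹ - (N⁻¹ * t - (N⁻¹ * t) ^ 2)
          = (N⁻¹ * t) ^ 3 / (1 + N⁻¹ * t) := by
        field_simp
        ring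
      rw [this]
      positivity
    have h2 : n * (N⁻¹ * t - (N⁻¹ * t) ^ 2) ≤ s :=
      mul_le_mul_of_nonneg_left h1 n.cast_nonneg
    have h3 : n * (N⁻¹ * t - (N⁻¹ * t) ^ 2) = (n * N⁻¹) * t - (n * N⁻¹) * (N⁻¹ * t ^ 2) := by ring
    have h4 : (p - N⁻¹) * t ≤ (n * N⁻¹) * t := by gcongr
    have h5 : (n * N⁻¹) * (N⁻¹ * t ^ 2) ≤ p * (N⁻¹ * 1) := by
      gcongr
      exact pow_le_one₀ ht ht1
    nlinarith
  have hpt : Real.exp (p * t) ≤ Real.exp p := Real.exp_le_exp.2 (by nlinarith)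
  have hes : Real.exp s ≤ Real.exp (p * t) := Real.exp_le_exp.2 hs1
  have h6 : Real.exp (p * t) * (1 + (s - p * t)) ≤ Real.exp s := by
    calc _ ≤ Real.exp (p * t) * Real.exp (s - p * t) := by
          gcongr
          linarith [Real.add_one_le_exp (s - p * t)]
      _ = Real.exp s := by rw [← Real.exp_add]; ring_nf
  rw [hs, abs_sub_comm, abs_of_nonneg (sub_nonneg.2 hes)]
  calc Real.exp (p * t) - Real.exp s ≤ Real.exp (p * t) * (p * t - s) := by linarith
    _ ≤ Real.exp p * ((1 + p) * N⁻¹) := by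
        gcongr
        linarith

lemma abs_profile_sub_expProfile_le {β p N : ℝ} (hβ : 0 ≤ β) (hp : 0 ≤ p) (hN : 0 < N) {w : ℝ}
    (hw : 0 ≤ w) :
    |profile β N⁻¹ ⌊p * N⌋₊ w - expProfile β p w| ≤ Real.exp p * ((1 + p) * N⁻¹) := by
  have h1 : 0 ≤ w / (1 + w) := by positivity
  have h2 : w / (1 + w) ≤ 1 := div_le_one_of_le₀ (by linarith) (by linarith)
  have h3 : (1 + w)⁻¹ ≤ 1 := inv_le_one_of_one_le₀ (by linarith)
  rw [profile, expProfile, ← mul_sub, abs_mul, abs_of_nonneg (by positivity), div_eq_mul_inv N⁻¹,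
    div_eq_mul_inv p]
  calc _ ≤ 1 * (Real.exp p * ((1 + p) * N⁻¹)) := by
        gcongr
        · exact Real.rpow_le_one h1 h2 hβ
        · exact abs_one_add_pow_sub_exp_le hp (by positivity) h3 hN
    _ = _ := one_mul _

lemma isScaleMixture_expProfile {β p q : ℝ} (hβ : 1 ≤ β) (hq : 0 ≤ q) (hqp : q ≤ p) :
    IsScaleMixture (expProfile β q) (expProfile β p) := by
  have hp := hq.trans hqp
  have hN : ∀ k : ℕ, (1 : ℝ) ≤ k + 1 := fun k => by simp
  have hcp := continuousOn_expProfile (by linarith : 0 ≤ β) p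
  choose θ hθ using fun k : ℕ => isScaleMixture_profile hβ (hN k)
    (Nat.floor_mono (mul_le_mul_of_nonneg_right hqp (zero_le_one.trans (hN k))))
  refine .of_tendsto hcp θ fun w hw => ?_
  have hlim : Tendsto (fun k : ℕ => Real.exp p * ((1 + p) * ((k : ℝ) + 1)⁻¹)
      + Real.exp q * ((1 + q) * ((k : ℝ) + 1)⁻¹)) atTop (𝓝 0) := by
    have h := tendsto_one_div_add_atTop_nhds_zero_nat (𝕜 := ℝ)
    simp only [one_div] at h
    simpa using ((h.const_mul (1 + p)).const_mul (Real.exp p)).add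
      ((h.const_mul (1 + q)).const_mul (Real.exp q))
  rw [tendsto_iff_norm_sub_tendsto_zero]
  refine squeeze_zero (fun _ => norm_nonneg _) (fun k => ?_) hlim
  have hk : (0 : ℝ) < k + 1 := by linarith [hN k]
  have e1 : ‖∫ x : I, (profile β ((k : ℝ) + 1)⁻¹ ⌊p * (k + 1)⌋₊ (w * x)
      - expProfile β p (w * x)) ∂(θ k : Measure I)‖ ≤ Real.exp p * ((1 + p) * ((k : ℝ) + 1)⁻¹) := by
    have hle : ∀ x : I, ‖profile β ((k : ℝ) + 1)⁻¹ ⌊p * (k + 1)⌋₊ (w * x)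
        - expProfile β p (w * x)‖ ≤ Real.exp p * ((1 + p) * ((k : ℝ) + 1)⁻¹) := fun x =>
      abs_profile_sub_expProfile_le (by linarith) hp hk (mul_nonneg hw x.2.1)
    simpa using norm_integral_le_of_norm_le_const (μ := (θ k : Measure I))
      (Eventually.of_forall hle)
  rw [integral_sub (integrable_unitInterval_of_continuous (continuous_comp_mul_unitInterval
      (continuousOn_profile (by linarith) _ _) hw) _)
    (integrable_unitInterval_of_continuous (continuous_comp_mul_unitInterval hcp hw) _),
    ← hθ k w hw, norm_sub_rev] at e1
  have e2 := abs_profile_sub_expProfile_le (by linarith : 0 ≤ β) hq hk hw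
  rw [← Real.norm_eq_abs] at e2
  exact (norm_sub_le_norm_sub_add_norm_sub _ _ _).trans (add_le_add e1 e2)

section GammaCDF

variable {ν : ℝ}

lemma integrable_gammaPDFReal (hν : 0 < ν) : Integrable (gammaPDFReal ν 1) := by
  refine ⟨by fun_prop, ?_⟩
  rw [hasFiniteIntegral_iff_ofReal (ae_of_all _ fun x => gammaPDFReal_nonneg hν one_pos x)]
  exact (lintegral_gammaPDF_eq_one hν one_pos).trans_lt ENNReal.one_lt_top

lemma gammaMeasure_Iic_zero (ν : ℝ) : gammaMeasure ν 1 (Iic 0) = 0 := by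
  rw [gammaMeasure, withDensity_apply _ measurableSet_Iic, ← setLIntegral_congr Iio_ae_eq_Iic]
  exact lintegral_gammaPDF_of_nonpos le_rfl

lemma cdf_gammaMeasure_zero (hν : 0 < ν) : cdf (gammaMeasure ν 1) 0 = 0 := by
  have := isProbabilityMeasure_gammaMeasure hν one_pos
  rw [cdf_eq_real, measureReal_def, gammaMeasure_Iic_zero, ENNReal.toReal_zero]

lemma cdf_gammaMeasure_eq_intervalIntegral (hν : 0 < ν) (x : ℝ) :
    cdf (gammaMeasure ν 1) x = ∫ t in (0 : ℝ)..x, gammaPDFReal ν 1 t := by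
  have hint := integrable_gammaPDFReal hν
  rw [← intervalIntegral.integral_Iic_sub_Iic hint.integrableOn hint.integrableOn,
    ← cdf_gammaMeasure_eq_integral hν one_pos, ← cdf_gammaMeasure_eq_integral hν one_pos,
    cdf_gammaMeasure_zero hν, sub_zero]

lemma continuous_cdf_gammaMeasure (hν : 0 < ν) : Continuous (cdf (gammaMeasure ν 1)) := by
  have h := intervalIntegral.continuous_primitive
    (fun _ _ => (integrable_gammaPDFReal hν).intervalIntegrable) 0
  simpa only [← cdf_gammaMeasure_eq_intervalIntegral hν] using h

lemma cdf_gammaMeasure_pos (hν : 0 < ν) {x : ℝ} (hx : 0 < x) :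
    0 < cdf (gammaMeasure ν 1) x := by
  rw [cdf_gammaMeasure_eq_intervalIntegral hν]
  exact intervalIntegral.intervalIntegral_pos_of_pos_on
    (integrable_gammaPDFReal hν).intervalIntegrable
    (fun t ht => gammaPDFReal_pos hν one_pos ht.1) hx

lemma hasDerivAt_cdf_gammaMeasure (hν : 0 < ν) {x : ℝ} (hx : 0 < x) :
    HasDerivAt (cdf (gammaMeasure ν 1)) (x ^ (ν - 1) * Real.exp (-x) / Real.Gamma ν) x := by
  have heq : gammaPDFReal ν 1 =ᶠ[𝓝 x] fun x => x ^ (ν - 1) * Real.exp (-x) / Real.Gamma ν := by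
    filter_upwards [lt_mem_nhds hx] with t ht
    rw [gammaPDFReal, if_pos ht.le, Real.one_rpow, one_mul]
    ring
  have hc : ContinuousAt (gammaPDFReal ν 1) x := by
    rw [continuousAt_congr heq]
    exact ((Real.continuousAt_rpow_const _ _ (Or.inl hx.ne')).mul (by fun_prop)).div_const _
  have h := intervalIntegral.integral_hasDerivAt_right (a := 0)
    (integrable_gammaPDFReal hν).intervalIntegrable
    ((stronglyMeasurable_gammaPDFReal ν 1).stronglyMeasurableAtFilter) hc
  rw [heq.self_of_nhds] at h
  simpa only [← cdf_gammaMeasure_eq_intervalIntegral hν] using h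

/-- The probability that `(Z / c - 1)_+` exceeds `1 / w`, where `Z` is inverse-gamma and
`p = 1 / (2 * c)`. -/
noncomputable def invGammaTail (ν p w : ℝ) : ℝ := cdf (gammaMeasure ν 1) (p * (w / (1 + w)))

lemma invGammaTail_nonneg (ν p w : ℝ) : 0 ≤ invGammaTail ν p w := cdf_nonneg _ _

lemma invGammaTail_le_one (ν p w : ℝ) : invGammaTail ν p w ≤ 1 := cdf_le_one _ _

lemma invGammaTail_zero (hν : 0 < ν) (p : ℝ) : invGammaTail ν p 0 = 0 := by
  simp [invGammaTail, cdf_gammaMeasure_zero hν]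

lemma continuousOn_invGammaTail (hν : 0 < ν) (p : ℝ) :
    ContinuousOn (invGammaTail ν p) (Ici 0) := by
  have h : ∀ w ∈ Ici (0 : ℝ), 1 + w ≠ 0 := fun w hw => by
    have : (0 : ℝ) ≤ w := hw
    positivity
  refine (continuous_cdf_gammaMeasure hν).comp_continuousOn ?_
  fun_prop (disch := assumption)

lemma tendsto_invGammaTail (hν : 0 < ν) (p : ℝ) :
    Tendsto (invGammaTail ν p) atTop (𝓝 (cdf (gammaMeasure ν 1) p)) := by
  refine ((continuous_cdf_gammaMeasure hν).tendsto p).comp ?_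
  have h1 : Tendsto (fun w : ℝ => 1 - (1 + w)⁻¹) atTop (𝓝 (1 - 0)) :=
    (tendsto_inv_atTop_zero.comp (tendsto_atTop_add_const_left _ _ tendsto_id)).const_sub 1
  have h2 : Tendsto (fun w : ℝ => w / (1 + w)) atTop (𝓝 1) := by
    rw [sub_zero] at h1
    refine h1.congr' ?_
    filter_upwards [eventually_gt_atTop 0] with w hw
    field_simp
    ring
  simpa using h2.const_mul p

lemma hasDerivAt_invGammaTail (hν : 0 < ν) {p : ℝ} (hp : 0 < p) {w : ℝ} (hw : 0 < w) :
    HasDerivAt (invGammaTail ν p)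
      (p ^ ν * Real.exp (-p) / Real.Gamma ν * (w ^ 2)⁻¹ * expProfile (ν + 1) p w) w := by
  have hw1 : 1 + w ≠ 0 := by positivity
  have hv : 0 < w / (1 + w) := by positivity
  have d0 : HasDerivAt (fun w : ℝ => 1 + w) 1 w := by
    simpa using (hasDerivAt_id w).const_add 1
  have d1 := ((hasDerivAt_id w).div d0 hw1).const_mul p
  have d2 := (hasDerivAt_cdf_gammaMeasure hν (mul_pos hp hv)).comp w d1
  refine d2.congr_deriv ?_
  have hG := (Real.Gamma_pos_of_pos hν).ne'
  have he : Real.exp (-(p * (w / (1 + w)))) = Real.exp (-p) * Real.exp (p / (1 + w)) := by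
    rw [← Real.exp_add]
    congr 1
    field_simp
    ring
  rw [he, expProfile, Real.mul_rpow hp.le hv.le, Real.rpow_sub_one hp.ne',
    Real.rpow_sub_one hv.ne', Real.rpow_add_one hv.ne']
  simp only [id]
  field_simp
  ring

end GammaCDF

lemma invGammaTail_eq_integral {ν p q : ℝ} (hν : 0 < ν) (hp : 0 < p) (hq : 0 < q)
    {θ : Measure I} [IsProbabilityMeasure θ]
    (hθ : ∀ w, 0 ≤ w → expProfile (ν + 1) q w = ∫ x : I, expProfile (ν + 1) p (w * x) ∂θ)
    {w : ℝ} (hw : 0 ≤ w) :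
    invGammaTail ν q w = ∫ x : I, (q ^ ν * Real.exp (-q)) / (p ^ ν * Real.exp (-p)) * x
      * invGammaTail ν p (w * x) ∂θ := by
  have hβ : 0 ≤ ν + 1 := by linarith
  set C := (q ^ ν * Real.exp (-q)) / (p ^ ν * Real.exp (-p)) with hC
  have hC0 : 0 < C := by positivity
  rcases hw.eq_or_lt with rfl | hw
  · simp [invGammaTail_zero hν]
  have hcont : ∀ v, 0 ≤ v → Continuous fun x : I => C * x * invGammaTail ν p (v * x) := fun v hv =>
    (by fun_prop : Continuous fun x : I => C * (x : ℝ)).mul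
      (continuous_comp_mul_unitInterval (continuousOn_invGammaTail hν p) hv)
  have hbd : ∀ v (x : I), ‖C * x * invGammaTail ν p (v * x)‖ ≤ C := fun v x => by
    have h1 := invGammaTail_nonneg ν p (v * x)
    have h2 := invGammaTail_le_one ν p (v * x)
    have h3 := x.2.1
    have h4 := x.2.2
    rw [Real.norm_eq_abs, abs_of_nonneg (by positivity), mul_assoc]
    exact mul_le_of_le_one_right hC0.le (mul_le_one₀ h4 h1 h2)
  have hRcont : ContinuousOn (fun v => ∫ x : I, C * x * invGammaTail ν p (v * x) ∂θ) (Icc 0 w) := by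
    refine continuousOn_of_dominated (bound := fun _ => C)
      (fun v hv => (hcont v hv.1).aestronglyMeasurable) (fun v _ => ae_of_all _ (hbd v))
      (integrable_const C) (ae_of_all _ fun x => ?_)
    exact continuousOn_const.mul ((continuousOn_invGammaTail hν p).comp (by fun_prop)
      fun v hv => mul_nonneg hv.1 x.2.1)
  have hRderiv : ∀ v ∈ Ioo 0 w, HasDerivAt (fun v => ∫ x : I, C * x * invGammaTail ν p (v * x) ∂θ)
      (q ^ ν * Real.exp (-q) / Real.Gamma ν * (v ^ 2)⁻¹ * expProfile (ν + 1) q v) v := by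
    intro v hv
    set K := C * (p ^ ν * Real.exp (-p) / Real.Gamma ν) with hK
    have hG := Real.Gamma_pos_of_pos hν
    have hK0 : 0 < K := by positivity
    have hv2 : 0 < v / 2 := half_pos hv.1
    have h := (hasDerivAt_integral_of_dominated_loc_of_deriv_le (μ := θ)
      (F := fun v (x : I) => C * x * invGammaTail ν p (v * x))
      (F' := fun v (x : I) => K * (v ^ 2)⁻¹ * expProfile (ν + 1) p (v * x))
      (bound := fun _ => K * ((v / 2) ^ 2)⁻¹ * Real.exp p)
      (Ioi_mem_nhds (half_lt_self hv.1))
      (by filter_upwards [lt_mem_nhds hv.1] with u hu using (hcont u hu.le).aestronglyMeasurable)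
      (integrable_unitInterval_of_continuous (hcont v hv.1.le) θ)
      (continuous_const.mul (continuous_comp_mul_unitInterval (continuousOn_expProfile hβ p)
        hv.1.le)).aestronglyMeasurable
      (ae_of_all _ fun x u hu => ?_) (integrable_const _) (ae_of_all _ fun x u hu => ?_)).2
    · refine h.congr_deriv ?_
      rw [integral_const_mul, ← hθ v hv.1.le, hK, hC]
      field_simp
    · have hu' : v / 2 < u := hu
      have hu0 : 0 < u := hv2.trans hu'
      rw [norm_mul, Real.norm_of_nonneg (by positivity : 0 ≤ K * (u ^ 2)⁻¹)]
      gcongr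
      exact abs_expProfile_le hβ hp.le (mul_nonneg hu0.le x.2.1)
    · have hu0 : 0 < u := hv2.trans hu
      rcases x.2.1.eq_or_lt with hx | hx
      · simp only [← hx, mul_zero, zero_mul]
        refine (hasDerivAt_const u (0 : ℝ)).congr_deriv ?_
        simp [expProfile, Real.zero_rpow (by linarith : ν + 1 ≠ 0)]
      · have e1 : HasDerivAt (fun u => u * (x : ℝ)) x u := by
          simpa using (hasDerivAt_id u).mul_const (x : ℝ)
        have e2 := ((hasDerivAt_invGammaTail hν hp (mul_pos hu0 hx)).comp u e1).const_mul
          (C * (x : ℝ))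
        refine e2.congr_deriv ?_
        rw [hK]
        field_simp
  obtain ⟨v, hv, hvw⟩ := exists_hasDerivAt_eq_slope
    (fun v => invGammaTail ν q v - ∫ x : I, C * x * invGammaTail ν p (v * x) ∂θ) (fun _ => 0) hw
    (((continuousOn_invGammaTail hν q).mono Icc_subset_Ici_self).sub hRcont)
    (fun v hv => ((hasDerivAt_invGammaTail hν hq hv.1).sub (hRderiv v hv)).congr_deriv (sub_self _))
  have hz := (div_eq_zero_iff.1 hvw.symm).resolve_right (by linarith)
  simp only [zero_mul, invGammaTail_zero hν, mul_zero, integral_zero, sub_zero] at hz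
  linarith

lemma integral_mul_le_one {ν p q : ℝ} (hν : 0 < ν) (hp : 0 < p) (hq : 0 < q) (hqp : q ≤ p)
    {θ : Measure I} [IsProbabilityMeasure θ]
    (hθ : ∀ w, 0 ≤ w → expProfile (ν + 1) q w = ∫ x : I, expProfile (ν + 1) p (w * x) ∂θ) :
    ∫ x : I, (q ^ ν * Real.exp (-q)) / (p ^ ν * Real.exp (-p)) * x ∂θ ≤ 1 := by
  set C := (q ^ ν * Real.exp (-q)) / (p ^ ν * Real.exp (-p))
  have hC0 : 0 < C := by positivity
  have hcont : Continuous fun x : I => C * (x : ℝ) := by fun_prop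
  have hlim : Tendsto (fun k : ℕ => ∫ x : I, C * x * invGammaTail ν p (k * x) ∂θ) atTop
      (𝓝 (∫ x : I, C * x * cdf (gammaMeasure ν 1) p ∂θ)) := by
    refine tendsto_integral_of_dominated_convergence (fun _ => C) (fun k => ?_)
      (integrable_const C) (fun k => ae_of_all _ fun x => ?_) (ae_of_all _ fun x => ?_)
    · exact (hcont.mul (continuous_comp_mul_unitInterval (continuousOn_invGammaTail hν p)
        k.cast_nonneg)).aestronglyMeasurable
    · have h1 := invGammaTail_nonneg ν p (k * x)
      have h2 := invGammaTail_le_one ν p (k * x)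
      have h3 := x.2.1
      have h4 := x.2.2
      rw [Real.norm_eq_abs, abs_of_nonneg (by positivity), mul_assoc]
      exact mul_le_of_le_one_right hC0.le (mul_le_one₀ h4 h1 h2)
    · rcases x.2.1.eq_or_lt with hx | hx
      · simp [← hx]
      · exact ((tendsto_invGammaTail hν p).comp
          (tendsto_natCast_atTop_atTop.atTop_mul_const hx)).const_mul _
  have heq : cdf (gammaMeasure ν 1) q = ∫ x : I, C * x * cdf (gammaMeasure ν 1) p ∂θ := by
    refine tendsto_nhds_unique ((tendsto_invGammaTail hν q).comp tendsto_natCast_atTop_atTop)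
      (hlim.congr fun k => ?_)
    exact (invGammaTail_eq_integral hν hp hq hθ k.cast_nonneg).symm
  rw [integral_mul_const] at heq
  have hp0 := cdf_gammaMeasure_pos hν hp
  have hmono := monotone_cdf (gammaMeasure ν 1) hqp
  rw [heq] at hmono
  exact le_of_mul_le_mul_right (by rwa [one_mul]) hp0

lemma invGammaLaw_lt_max {ν c y : ℝ} (hν : 0 < ν) (hc : 0 < c) (hy : 0 < y) :
    invGammaLaw ν {z | y < max (z / c - 1) 0}
      = ENNReal.ofReal (invGammaTail ν (1 / (2 * c)) y⁻¹) := by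
  have := isProbabilityMeasure_gammaMeasure hν one_pos
  set r := 1 / (2 * c) * (y⁻¹ / (1 + y⁻¹)) with hr
  have hr' : r = 1 / (2 * c * (1 + y)) := by rw [hr]; field_simp; ring
  rw [invGammaLaw, Measure.map_apply (by fun_prop)
    (measurableSet_lt measurable_const (by fun_prop)), invGammaTail, ofReal_cdf]
  have hset : (fun x : ℝ => 1 / (2 * x)) ⁻¹' {z | y < max (z / c - 1) 0} = Ioo 0 r := by
    ext x
    simp only [mem_preimage, mem_ofPred_eq, mem_Ioo, lt_max_iff, not_lt_of_gt hy, or_false]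
    rcases le_or_gt x 0 with hx | hx
    · have h1 : 1 / (2 * x) / c ≤ 0 :=
        div_nonpos_of_nonpos_of_nonneg (div_nonpos_of_nonneg_of_nonpos zero_le_one (by linarith))
          hc.le
      exact ⟨fun h => by linarith, fun h => absurd h.1 (not_lt_of_ge hx)⟩
    · rw [hr', lt_div_iff₀ (by positivity), lt_sub_iff_add_lt, div_div,
        lt_div_iff₀ (by positivity)]
      constructor
      · intro h
        exact ⟨hx, by nlinarith⟩
      · rintro ⟨-, h⟩
        nlinarith
  have hae : (Ioo 0 r : Set ℝ) =ᵐ[gammaMeasure ν 1] Iic r := by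
    have h1 : ∀ᵐ x ∂gammaMeasure ν 1, x ∉ Iic (0 : ℝ) :=
      measure_eq_zero_iff_ae_notMem.1 (gammaMeasure_Iic_zero ν)
    have h2 : ∀ᵐ x ∂gammaMeasure ν 1, x ≠ r := by
      have : gammaMeasure ν 1 {r} = 0 :=
        withDensity_absolutelyContinuous _ _ (measure_singleton r)
      exact measure_eq_zero_iff_ae_notMem.1 this
    filter_upwards [h1, h2] with x hx1 hx2
    have hx1' : 0 < x := not_le.1 hx1
    exact propext ⟨fun h => h.2.le, fun h => ⟨hx1', lt_of_le_of_ne h hx2⟩⟩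
  rw [hset, measure_congr hae]

lemma ext_of_Ioi_of_pos {μ μ' : Measure ℝ} [IsProbabilityMeasure μ] [IsProbabilityMeasure μ']
    (h : μ (Iio 0) = 0) (h' : μ' (Iio 0) = 0) (hI : ∀ y, 0 < y → μ (Ioi y) = μ' (Ioi y)) :
    μ = μ' := by
  have hpos : ∀ y, 0 < y → cdf μ y = cdf μ' y := fun y hy => by
    rw [cdf_eq_real, cdf_eq_real, ← compl_Ioi, probReal_compl_eq_one_sub measurableSet_Ioi,
      probReal_compl_eq_one_sub measurableSet_Ioi, measureReal_def, measureReal_def, hI y hy]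
  refine Measure.eq_of_cdf _ _ (StieltjesFunction.ext fun y => ?_)
  rcases lt_or_ge y 0 with hy | hy
  · rw [cdf_eq_real, cdf_eq_real, measureReal_def, measureReal_def,
      measure_mono_null (Iic_subset_Iio.2 hy) h, measure_mono_null (Iic_subset_Iio.2 hy) h']
  · refine tendsto_nhds_unique (((cdf μ).right_continuous y).mono Ioi_subset_Ici_self)
      ((((cdf μ').right_continuous y).mono Ioi_subset_Ici_self).congr' ?_)
    filter_upwards [self_mem_nhdsWithin] with x hx
    exact (hpos x (hy.trans_lt hx)).symm

/-- The law of a `[0,1]`-valued variable which is `C x θ(dx)` on `(0,1]`, the missing mass being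
placed at `0`. -/
noncomputable def sizeBiasedLaw (C : ℝ) (θ : Measure I) : Measure I :=
  (θ.withDensity fun x => ENNReal.ofReal (C * x))
    + ENNReal.ofReal (1 - ∫ x : I, C * x ∂θ) • Measure.dirac 0

lemma isProbabilityMeasure_sizeBiasedLaw {C : ℝ} (hC : 0 ≤ C) {θ : Measure I}
    [IsProbabilityMeasure θ] (h1 : ∫ x : I, C * x ∂θ ≤ 1) :
    IsProbabilityMeasure (sizeBiasedLaw C θ) := by
  constructor
  have hnn : ∀ x : I, 0 ≤ C * (x : ℝ) := fun x => mul_nonneg hC x.2.1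
  have hi : Integrable (fun x : I => C * (x : ℝ)) θ :=
    integrable_unitInterval_of_continuous (by fun_prop) _
  rw [sizeBiasedLaw, Measure.add_apply, withDensity_apply _ MeasurableSet.univ, setLIntegral_univ,
    ← ofReal_integral_eq_lintegral_ofReal hi (ae_of_all _ hnn), Measure.smul_apply, measure_univ,
    smul_eq_mul, mul_one, ← ENNReal.ofReal_add (integral_nonneg hnn) (sub_nonneg.2 h1),
    add_sub_cancel, ENNReal.ofReal_one]

lemma lintegral_sizeBiasedLaw {C : ℝ} (hC : 0 ≤ C) {θ : Measure I} {φ : ℝ → ℝ}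
    (hφm : Measurable fun x : I => φ x) (h0 : φ 0 = 0) :
    ∫⁻ x : I, ENNReal.ofReal (φ x) ∂(sizeBiasedLaw C θ)
      = ∫⁻ x : I, ENNReal.ofReal (C * x * φ x) ∂θ := by
  rw [sizeBiasedLaw, lintegral_add_measure, lintegral_smul_measure, lintegral_dirac,
    lintegral_withDensity_eq_lintegral_mul _ (by fun_prop) hφm.ennreal_ofReal]
  simp only [Icc.coe_zero, h0, ENNReal.ofReal_zero, smul_zero, add_zero, Pi.mul_apply]
  exact lintegral_congr fun x => (ENNReal.ofReal_mul (mul_nonneg hC x.2.1)).symm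

theorem stmt15 (ν b c : ℝ) (hν : 0 < ν) (hc : 0 < c) (hcb : c < b) :
    ∃ (Ω : Type) (_ : MeasurableSpace Ω) (P : Measure Ω) (Z S : Ω → ℝ),
      IsProbabilityMeasure P ∧ Measurable Z ∧ Measurable S ∧
      Measure.map Z P = invGammaLaw ν ∧
      (∀ ω, S ω ∈ Set.Icc (0:ℝ) 1) ∧ IndepFun S Z P ∧
      Measure.map (fun ω => max (Z ω / b - 1) 0) P
        = Measure.map (fun ω => S ω * max (Z ω / c - 1) 0) P := by
  set q := 1 / (2 * b) with hq
  set p := 1 / (2 * c) with hp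
  have hb : 0 < b := hc.trans hcb
  have hq0 : 0 < q := by positivity
  have hp0 : 0 < p := by positivity
  have hqp : q ≤ p := one_div_le_one_div_of_le (by positivity) (by linarith)
  obtain ⟨θ, hθ⟩ := isScaleMixture_expProfile (by linarith : 1 ≤ ν + 1) hq0.le hqp
  set C := (q ^ ν * Real.exp (-q)) / (p ^ ν * Real.exp (-p)) with hC
  have hC0 : 0 ≤ C := by positivity
  have := isProbabilityMeasure_gammaMeasure hν one_pos
  have hZ : IsProbabilityMeasure (invGammaLaw ν) :=
    Measure.isProbabilityMeasure_map (by fun_prop)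
  have hS := isProbabilityMeasure_sizeBiasedLaw hC0 (integral_mul_le_one hν hp0 hq0 hqp hθ)
  set P := (sizeBiasedLaw C (θ : Measure I)).prod (invGammaLaw ν) with hP
  have hmZ : Measurable fun ω : I × ℝ => ω.2 := measurable_snd
  have hmS : Measurable fun ω : I × ℝ => (ω.1 : ℝ) := by fun_prop
  have hsnd : Measure.map (fun ω : I × ℝ => ω.2) P = invGammaLaw ν := by
    rw [hP, Measure.map_snd_prod, measure_univ, one_smul]
  have hm1 : Measurable fun ω : I × ℝ => max (ω.2 / b - 1) 0 := by fun_prop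
  have hm2 : Measurable fun ω : I × ℝ => (ω.1 : ℝ) * max (ω.2 / c - 1) 0 := by fun_prop
  refine ⟨I × ℝ, inferInstance, P, fun ω => ω.2, fun ω => ω.1, inferInstance, hmZ, hmS, hsnd,
    fun ω => ω.1.2, indepFun_prod (X := fun x : I => (x : ℝ)) (Y := fun z : ℝ => z)
      (by fun_prop) (by fun_prop), ?_⟩
  have := Measure.isProbabilityMeasure_map (μ := P) hm1.aemeasurable
  have := Measure.isProbabilityMeasure_map (μ := P) hm2.aemeasurable
  refine ext_of_Ioi_of_pos ?_ ?_ fun y hy => ?_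
  · rw [Measure.map_apply hm1 measurableSet_Iio]
    convert measure_empty (μ := P)
    ext ω
    simp
  · rw [Measure.map_apply hm2 measurableSet_Iio]
    convert measure_empty (μ := P)
    ext ω
    simpa using mul_nonneg ω.1.2.1 (le_max_right (ω.2 / c - 1) 0)
  · rw [Measure.map_apply hm1 measurableSet_Ioi, Measure.map_apply hm2 measurableSet_Ioi]
    have hL : P ((fun ω : I × ℝ => max (ω.2 / b - 1) 0) ⁻¹' Ioi y)
        = ENNReal.ofReal (invGammaTail ν q y⁻¹) := by
      rw [← invGammaLaw_lt_max hν hb hy, ← hsnd,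
        Measure.map_apply hmZ (measurableSet_lt measurable_const (by fun_prop))]
      rfl
    have hy0 : 0 ≤ y⁻¹ := by positivity
    have hcont := continuous_comp_mul_unitInterval (continuousOn_invGammaTail hν p) hy0
    have hcontC : Continuous fun x : I => C * x * invGammaTail ν p (y⁻¹ * x) :=
      (by fun_prop : Continuous fun x : I => C * (x : ℝ)).mul hcont
    rw [hL, invGammaTail_eq_integral hν hp0 hq0 hθ hy0, ofReal_integral_eq_lintegral_ofReal
      (integrable_unitInterval_of_continuous hcontC _) (ae_of_all _ fun x => mul_nonneg
        (mul_nonneg hC0 x.2.1) (invGammaTail_nonneg _ _ _)),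
      ← lintegral_sizeBiasedLaw hC0 (φ := fun x => invGammaTail ν p (y⁻¹ * x)) hcont.measurable
        (by simp [invGammaTail_zero hν]), hP, Measure.prod_apply (hm2 measurableSet_Ioi)]
    refine lintegral_congr fun x => ?_
    rcases x.2.1.eq_or_lt with hx | hx
    · have : Prod.mk x ⁻¹' ((fun ω : I × ℝ => (ω.1 : ℝ) * max (ω.2 / c - 1) 0) ⁻¹' Ioi y) = ∅ := by
        ext z
        simp [← hx, hy.le]
      rw [this, measure_empty, ← hx, mul_zero, invGammaTail_zero hν, ENNReal.ofReal_zero]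
    · have : Prod.mk x ⁻¹' ((fun ω : I × ℝ => (ω.1 : ℝ) * max (ω.2 / c - 1) 0) ⁻¹' Ioi y)
          = {z | y / x < max (z / c - 1) 0} := by
        ext z
        exact (div_lt_iff₀' hx).symm
      rw [this, invGammaLaw_lt_max hν hc (div_pos hy hx), inv_div,
        mul_comm y⁻¹ (x : ℝ), ← div_eq_mul_inv]
end
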